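/- Let (α,α') satisfy β1'(+∞) ≤ α ≤ β1'(−∞) and β2'(+∞) ≤ α' ≤ β2'(−∞), and suppose it is NOT the case that both β1'(1) ≤ α ≤ β1'(0) and β2'(+∞) ≤ α' < β2'(1). Then dim_H E(μ,α,α') = min{ dim_H E̲(μ,α), dim_H Ē(μ,α') }. -/

import Mathlib

open MeasureTheory Filter Set Metric Topology

/-- `moranCyl c w n (x, ℓ)` refines the interval `[x, x + ℓ]` along the binary word `w`,
using the contraction ratio `c k` at step `k` (the first letter of `w` is processed with
index `n`).  The result `(x', ℓ')` describes the interval `[x', x' + ℓ']`. -/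
noncomputable def moranCyl (c : ℕ → ℝ) : List Bool → ℕ → ℝ × ℝ → ℝ × ℝ
  | [], _, st => st
  | bb :: w, n, st =>
      moranCyl c w (n + 1)
        (if bb then (st.1 + st.2 - st.2 / c n, st.2 / c n) else (st.1, st.2 / c n))

/-- The basic interval `I_w` of the Moran construction with ratios `c`. -/
noncomputable def moranI (c : ℕ → ℝ) (w : List Bool) : Set ℝ :=
  Icc (moranCyl c w 1 (0, 1)).1 ((moranCyl c w 1 (0, 1)).1 + (moranCyl c w 1 (0, 1)).2)

/-- The length `|I_w|` of the basic interval `I_w`. -/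
noncomputable def moranLen (c : ℕ → ℝ) (w : List Bool) : ℝ :=
  (moranCyl c w 1 (0, 1)).2

/-- The Moran set `⋂ n ⋃ {I_w : |w| = n}`. -/
noncomputable def moranSet (c : ℕ → ℝ) : Set ℝ :=
  ⋂ n : ℕ, ⋃ w ∈ {w : List Bool | w.length = n}, moranI c w

/-- The mass assigned to the cylinder `I_w` by the Moran measure with weight `r k` for the
letter at step `k`: `cylMass r w 1 1 = μ(I_w)`. -/
noncomputable def cylMass (r : ℕ → ℝ) : List Bool → ℕ → ℝ → ℝ
  | [], _, m => m
  | bb :: w, n, m => cylMass r w (n + 1) (if bb then (1 - r n) * m else r n * m)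

/-- Lower local dimension `liminf_{r → 0⁺} log μ(B(x,r)) / log r`. -/
noncomputable def lowerLocalDim (μ : Measure ℝ) (x : ℝ) : ℝ :=
  liminf (fun rr : ℝ => Real.log (μ (closedBall x rr)).toReal / Real.log rr) (𝓝[>] 0)

/-- Upper local dimension `limsup_{r → 0⁺} log μ(B(x,r)) / log r`. -/
noncomputable def upperLocalDim (μ : Measure ℝ) (x : ℝ) : ℝ :=
  limsup (fun rr : ℝ => Real.log (μ (closedBall x rr)).toReal / Real.log rr) (𝓝[>] 0)

/-- `betaFn ρ C s = -log (ρ^s + (1-ρ)^s) / log C`; so `β₁ = betaFn p A`, `β₂ = betaFn q B`. -/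
noncomputable def betaFn (ρ C : ℝ) (s : ℝ) : ℝ :=
  -Real.log (ρ ^ s + (1 - ρ) ^ s) / Real.log C

/-- The Legendre transform `f^*(α) = inf_s (s α - f(s))`. -/
noncomputable def legendre (f : ℝ → ℝ) (α : ℝ) : ℝ :=
  ⨅ s : ℝ, (s * α - f s)

/-- The modification `β̃₁` of `β₁`, linear on `(0,1)`. -/
noncomputable def betaTilde1 (ρ C : ℝ) (s : ℝ) : ℝ :=
  if s ≤ 0 ∨ 1 ≤ s then betaFn ρ C s
  else (1 - s) * betaFn ρ C 0 + s * betaFn ρ C 1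

/-- `packSup μ X r s` is the supremum of `∑ᵢ μ(B(xᵢ,r))^s` over all finite families of
pairwise disjoint closed balls of radius `r` with centers in `X`. -/
noncomputable def packSup (μ : Measure ℝ) (X : Set ℝ) (rr s : ℝ) : ℝ :=
  sSup {y : ℝ | ∃ t : Finset ℝ, (↑t : Set ℝ) ⊆ X ∧
    (↑t : Set ℝ).Pairwise (fun u v => Disjoint (closedBall u rr) (closedBall v rr)) ∧
    y = ∑ u ∈ t, (μ (closedBall u rr)).toReal ^ s}

/-- The first `n` letters of `ω`. -/
def pref (ω : ℕ → Bool) (n : ℕ) : List Bool := (List.range n).map ω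

/-- `log (1 / |I_w|)` for the words `w` of length `n`. -/
noncomputable def logScale (c : ℕ → ℝ) (n : ℕ) : ℝ := ∑ k ∈ Finset.range n, Real.log (c (k + 1))

/-- The common length of the basic intervals of level `n`. -/
noncomputable def levelLen (c : ℕ → ℝ) (n : ℕ) : ℝ := ∏ k ∈ Finset.range n, (c (k + 1))⁻¹

/-- The left end of the basic interval of level `n` coded by `ω`. -/
noncomputable def leftEnd (c : ℕ → ℝ) (ω : ℕ → Bool) (n : ℕ) : ℝ :=
  ∑ k ∈ Finset.range n, if ω k then levelLen c k - levelLen c (k + 1) else 0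

/-- The basic interval of level `n` coded by `ω`. -/
noncomputable def cell (c : ℕ → ℝ) (ω : ℕ → Bool) (n : ℕ) : Set ℝ :=
  Icc (leftEnd c ω n) (leftEnd c ω n + levelLen c n)

/-- The product weight of the first `n` letters of `ω`, the letter `false` having weight `θ k`
at place `k`. -/
noncomputable def prefixMass (θ : ℕ → ℝ) (ω : ℕ → Bool) (n : ℕ) : ℝ :=
  ∏ k ∈ Finset.range n, if ω k then 1 - θ k else θ k

lemma pref_succ (ω : ℕ → Bool) (n : ℕ) : pref ω (n + 1) = pref ω n ++ [ω n] := by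
  simp [pref, List.range_succ]

@[simp] lemma length_pref (ω : ℕ → Bool) (n : ℕ) : (pref ω n).length = n := by simp [pref]

lemma pref_eq_iff {ω ω' : ℕ → Bool} {n : ℕ} : pref ω n = pref ω' n ↔ ∀ k < n, ω k = ω' k := by
  simp [pref, List.map_inj_left]

lemma moranCyl_append (c : ℕ → ℝ) (b : Bool) (w : List Bool) (n : ℕ) (st : ℝ × ℝ) :
    moranCyl c (w ++ [b]) n st = moranCyl c [b] (n + w.length) (moranCyl c w n st) := by
  induction w generalizing n st with
  | nil => simp [moranCyl]
  | cons a w ih =>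
    simp only [List.cons_append, moranCyl, ih, List.length_cons]
    congr 1 <;> first
      | rfl
      | (congr 1; omega)
      | (simp only [show n + 1 + w.length = n + (w.length + 1) by omega])

lemma cylMass_append (r : ℕ → ℝ) (b : Bool) (w : List Bool) (n : ℕ) (m : ℝ) :
    cylMass r (w ++ [b]) n m = cylMass r [b] (n + w.length) (cylMass r w n m) := by
  induction w generalizing n m with
  | nil => simp [cylMass]
  | cons a w ih =>
    simp only [List.cons_append, cylMass, ih, List.length_cons]
    simp only [show n + 1 + w.length = n + (w.length + 1) by omega]

lemma levelLen_succ (c : ℕ → ℝ) (n : ℕ) : levelLen c (n + 1) = levelLen c n * (c (n + 1))⁻¹ := by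
  rw [levelLen, Finset.prod_range_succ, ← levelLen]

lemma leftEnd_succ (c : ℕ → ℝ) (ω : ℕ → Bool) (n : ℕ) : leftEnd c ω (n + 1) =
    leftEnd c ω n + if ω n then levelLen c n - levelLen c (n + 1) else 0 := by
  simp [leftEnd, Finset.sum_range_succ]

lemma moranCyl_pref (c : ℕ → ℝ) (ω : ℕ → Bool) (n : ℕ) :
    moranCyl c (pref ω n) 1 (0, 1) = (leftEnd c ω n, levelLen c n) := by
  induction n with
  | zero => simp [pref, moranCyl, leftEnd, levelLen]
  | succ n ih =>
    rw [pref_succ, moranCyl_append, ih, leftEnd_succ, levelLen_succ]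
    simp only [moranCyl, length_pref, add_comm 1 n, div_eq_mul_inv]
    split_ifs <;> simp [add_sub_assoc]

lemma moranI_pref (c : ℕ → ℝ) (ω : ℕ → Bool) (n : ℕ) : moranI c (pref ω n) = cell c ω n := by
  simp [moranI, moranCyl_pref, cell]

lemma prefixMass_succ (θ : ℕ → ℝ) (ω : ℕ → Bool) (n : ℕ) : prefixMass θ ω (n + 1) =
    prefixMass θ ω n * if ω n then 1 - θ n else θ n := by
  rw [prefixMass, Finset.prod_range_succ, ← prefixMass]

lemma cylMass_pref (r : ℕ → ℝ) (ω : ℕ → Bool) (n : ℕ) :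
    cylMass r (pref ω n) 1 1 = prefixMass (fun k => r (k + 1)) ω n := by
  induction n with
  | zero => simp [pref, cylMass, prefixMass]
  | succ n ih =>
    rw [pref_succ, cylMass_append, ih, prefixMass_succ]
    simp only [cylMass, length_pref, add_comm 1 n]
    split_ifs <;> simp [mul_comm]

lemma exists_pref_eq (w : List Bool) : ∃ ω : ℕ → Bool, pref ω w.length = w := by
  refine ⟨fun k => w.getD k false, ?_⟩
  apply List.ext_getElem <;> simp [pref]
  intro i h
  simp [h]

section Geometry

variable {c : ℕ → ℝ} {B : ℝ}

lemma levelLen_pos (hB : 2 < B) (hc : ∀ k, B ≤ c (k + 1)) (n : ℕ) : 0 < levelLen c n :=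
  Finset.prod_pos fun k _ => inv_pos.2 (by linarith [hc k])

lemma levelLen_eq_exp (hB : 2 < B) (hc : ∀ k, B ≤ c (k + 1)) (n : ℕ) :
    levelLen c n = Real.exp (-logScale c n) := by
  rw [levelLen, logScale, ← Finset.sum_neg_distrib, Real.exp_sum]
  refine Finset.prod_congr rfl fun k _ => ?_
  rw [Real.exp_neg, Real.exp_log (by linarith [hc k])]

lemma levelLen_succ_le (hB : 2 < B) (hc : ∀ k, B ≤ c (k + 1)) (n : ℕ) :
    levelLen c (n + 1) ≤ levelLen c n * B⁻¹ := by
  rw [levelLen_succ]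
  have := levelLen_pos hB hc n
  gcongr
  exact hc n

lemma levelLen_antitone (hB : 2 < B) (hc : ∀ k, B ≤ c (k + 1)) : Antitone (levelLen c) := by
  refine antitone_nat_of_succ_le fun n => (levelLen_succ_le hB hc n).trans ?_
  exact mul_le_of_le_one_right (levelLen_pos hB hc n).le (inv_le_one_of_one_le₀ (by linarith))

lemma cell_succ_subset (hB : 2 < B) (hc : ∀ k, B ≤ c (k + 1)) (ω : ℕ → Bool) (n : ℕ) :
    cell c ω (n + 1) ⊆ cell c ω n := by
  have h1 := levelLen_antitone hB hc (Nat.le_succ n)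
  have h2 := levelLen_pos hB hc (n + 1)
  simp only [Nat.succ_eq_add_one] at h1
  rw [cell, cell, leftEnd_succ]
  apply Icc_subset_Icc <;> split_ifs <;> linarith

lemma cell_antitone (hB : 2 < B) (hc : ∀ k, B ≤ c (k + 1)) (ω : ℕ → Bool) :
    Antitone (cell c ω) :=
  antitone_nat_of_succ_le (cell_succ_subset hB hc ω)

lemma cell_congr {ω ω' : ℕ → Bool} {n : ℕ} (h : ∀ k < n, ω k = ω' k) :
    cell c ω n = cell c ω' n := by
  rw [← moranI_pref, ← moranI_pref, pref_eq_iff.2 h]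

lemma leftEnd_congr {ω ω' : ℕ → Bool} {n : ℕ} (h : ∀ k < n, ω k = ω' k) :
    leftEnd c ω n = leftEnd c ω' n :=
  Finset.sum_congr rfl fun k hk => by rw [h k (Finset.mem_range.1 hk)]

/-- Points of distinct basic intervals of level `n` are far apart. -/
lemma le_dist_of_mem_cell (hB : 2 < B) (hc : ∀ k, B ≤ c (k + 1)) {ω ω' : ℕ → Bool} {n : ℕ}
    (h : ¬ ∀ k < n, ω k = ω' k) {x y : ℝ} (hx : x ∈ cell c ω n) (hy : y ∈ cell c ω' n) :
    (1 - 2 / B) * levelLen c n ≤ |x - y| := by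
  push Not at h
  have hj := Nat.find_spec h
  set j := Nat.find h with hjdef
  have hlt : ∀ k < j, ω k = ω' k := fun k hk => by
    by_contra hne
    exact Nat.find_min h hk ⟨hk.trans hj.1, hne⟩
  have hx' := cell_antitone hB hc ω (Nat.succ_le_of_lt hj.1) hx
  have hy' := cell_antitone hB hc ω' (Nat.succ_le_of_lt hj.1) hy
  have hle := leftEnd_congr (c := c) hlt
  have h1 := levelLen_succ_le hB hc j
  have h2 := levelLen_antitone hB hc hj.1.le
  have h3 := levelLen_pos hB hc j
  have hB' : 2 / B = 2 * B⁻¹ := rfl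
  have h0 : 0 < B⁻¹ := by positivity
  have h4 : 0 ≤ 1 - 2 / B := by
    rw [sub_nonneg, div_le_one (by linarith)]; exact hB.le
  have h5 := mul_le_mul_of_nonneg_left h2 h4
  refine h5.trans ?_
  simp only [Nat.succ_eq_add_one, cell, mem_Icc, leftEnd_succ] at hx' hy'
  rw [hle] at hx'
  rcases hω : ω j <;> rcases hω' : ω' j <;> simp only [hω, hω', ne_eq, not_true_eq_false,
    and_false, Bool.false_eq_true, if_true, if_false] at hj hx' hy'
  · rw [abs_sub_comm]
    refine le_trans ?_ (le_abs_self _)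
    nlinarith
  · refine le_trans ?_ (le_abs_self _)
    nlinarith

lemma agree_of_mem_cell (hB : 2 < B) (hc : ∀ k, B ≤ c (k + 1)) {ω ω' : ℕ → Bool} {n : ℕ}
    {x : ℝ} (hx : x ∈ cell c ω n) (hy : x ∈ cell c ω' n) : ∀ k < n, ω k = ω' k := by
  by_contra h
  have := le_dist_of_mem_cell hB hc h hx hy
  have h4 : 0 < 1 - 2 / B := by
    rw [sub_pos, div_lt_one (by linarith)]; exact hB
  have := mul_pos h4 (levelLen_pos hB hc n)
  simp at *
  linarith

/-- Every point of the Moran set has a coding. -/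
lemma exists_coding (hB : 2 < B) (hc : ∀ k, B ≤ c (k + 1)) {x : ℝ} (hx : x ∈ moranSet c) :
    ∃ ω : ℕ → Bool, ∀ n, x ∈ cell c ω n := by
  have h : ∀ n, ∃ ω : ℕ → Bool, x ∈ cell c ω n := by
    intro n
    simp only [moranSet, mem_iInter, mem_iUnion, mem_ofPred_eq] at hx
    obtain ⟨w, hw, hxw⟩ := hx n
    obtain ⟨ω, hω⟩ := exists_pref_eq w
    refine ⟨ω, ?_⟩
    rw [← moranI_pref, ← hw, hω]
    exact hxw
  choose f hf using h
  refine ⟨fun n => f (n + 1) n, fun n => ?_⟩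
  rw [cell_congr (ω' := f n)]
  · exact hf n
  · intro k hk
    exact agree_of_mem_cell hB hc (hf (k + 1)) (cell_antitone hB hc _ hk (hf n)) k k.lt_succ_self

lemma mem_moranSet_of_mem_cell {x : ℝ} {ω : ℕ → Bool} (h : ∀ n, x ∈ cell c ω n) :
    x ∈ moranSet c := by
  simp only [moranSet, mem_iInter, mem_iUnion, mem_ofPred_eq]
  exact fun n => ⟨pref ω n, length_pref ω n, moranI_pref c ω n ▸ h n⟩

lemma logScale_mono_bounds {A : ℝ} (hB : 2 < B) (hc : ∀ k, B ≤ c (k + 1))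
    (hcA : ∀ k, c (k + 1) ≤ A) (n : ℕ) :
    n * Real.log B ≤ logScale c n ∧ logScale c n ≤ n * Real.log A := by
  constructor
  · have := Finset.card_nsmul_le_sum (Finset.range n) (fun k => Real.log (c (k + 1)))
      (Real.log B) fun k _ => Real.log_le_log (by linarith) (hc k)
    simpa [logScale] using this
  · have := Finset.sum_le_card_nsmul (Finset.range n) (fun k => Real.log (c (k + 1)))
      (Real.log A) fun k _ => Real.log_le_log (by linarith [hc k]) (hcA k)
    simpa [logScale] using this

lemma tendsto_levelLen (hB : 2 < B) (hc : ∀ k, B ≤ c (k + 1)) :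
    Tendsto (levelLen c) atTop (𝓝 0) := by
  have h : ∀ n, levelLen c n ≤ B⁻¹ ^ n := by
    intro n
    rw [levelLen, ← Finset.card_range n, ← Finset.prod_const, Finset.card_range]
    refine Finset.prod_le_prod (fun k _ => inv_nonneg.2 (by linarith [hc k])) fun k _ => ?_
    exact inv_anti₀ (by linarith) (hc k)
  refine squeeze_zero (fun n => (levelLen_pos hB hc n).le) h ?_
  exact tendsto_pow_atTop_nhds_zero_of_lt_one (by positivity) (inv_lt_one_of_one_lt₀ (by linarith))

/-- The point coded by `ω`. -/
noncomputable def codedPoint (c : ℕ → ℝ) (ω : ℕ → Bool) : ℝ := ⨆ n, leftEnd c ω n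

lemma codedPoint_mem_cell (hB : 2 < B) (hc : ∀ k, B ≤ c (k + 1)) (ω : ℕ → Bool) (n : ℕ) :
    codedPoint c ω ∈ cell c ω n := by
  have hmono : Monotone (leftEnd c ω) := by
    refine monotone_nat_of_le_succ fun n => ?_
    rw [leftEnd_succ]
    have h1 := levelLen_antitone hB hc (Nat.le_succ n)
    simp only [Nat.succ_eq_add_one] at h1
    split_ifs <;> linarith
  have hle : ∀ m n, leftEnd c ω m ≤ leftEnd c ω n + levelLen c n := by
    intro m n
    have hm := levelLen_pos hB hc (max m n)
    have h : leftEnd c ω (max m n) ∈ cell c ω (max m n) := ⟨le_rfl, by linarith⟩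
    exact (hmono (le_max_left m n)).trans (cell_antitone hB hc ω (le_max_right m n) h).2
  exact ⟨le_ciSup (f := leftEnd c ω) ⟨_, by rintro _ ⟨m, rfl⟩; exact hle m 0⟩ n,
    ciSup_le fun m => hle m n⟩

lemma measurable_codedPoint (hB : 2 < B) (hc : ∀ k, B ≤ c (k + 1)) :
    Measurable (codedPoint c) := by
  have h : ∀ n, Measurable fun ω => leftEnd c ω n := by
    intro n
    unfold leftEnd
    refine Finset.measurable_sum _ fun k _ => ?_
    exact (measurable_of_countable fun b : Bool =>
      if b then levelLen c k - levelLen c (k + 1) else 0).comp (measurable_pi_apply k)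
  refine measurable_of_tendsto_metrizable h (tendsto_pi_nhds.2 fun ω => ?_)
  have h1 : ∀ n, dist (leftEnd c ω n) (codedPoint c ω) ≤ levelLen c n := fun n => by
    have := codedPoint_mem_cell hB hc ω n
    rw [cell, mem_Icc] at this
    rw [Real.dist_eq, abs_le]
    constructor <;> linarith [levelLen_pos hB hc n]
  exact tendsto_iff_dist_tendsto_zero.2
    (squeeze_zero (fun _ => dist_nonneg) h1 (tendsto_levelLen hB hc))

end Geometry

/-- The information `∑ -log (weight)` carried by the first `n` letters of `ω`. -/
noncomputable def infoSum (θ : ℕ → ℝ) (ω : ℕ → Bool) (n : ℕ) : ℝ :=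
  ∑ k ∈ Finset.range n, -Real.log (if ω k then 1 - θ k else θ k)

lemma infoSum_succ (θ : ℕ → ℝ) (ω : ℕ → Bool) (n : ℕ) : infoSum θ ω (n + 1) =
    infoSum θ ω n + -Real.log (if ω n then 1 - θ n else θ n) := by
  rw [infoSum, Finset.sum_range_succ, ← infoSum]

section Info

variable {θ : ℕ → ℝ} {ρ : ℝ}

lemma letter_bounds (hρ : 0 < ρ) (hθ : ∀ k, ρ ≤ θ k ∧ θ k ≤ 1 - ρ) (ω : ℕ → Bool) (k : ℕ) :
    0 < (if ω k then 1 - θ k else θ k) ∧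
      0 ≤ -Real.log (if ω k then 1 - θ k else θ k) ∧
      -Real.log (if ω k then 1 - θ k else θ k) ≤ -Real.log ρ := by
  obtain ⟨h1, h2⟩ := hθ k
  have h3 : ρ ≤ (if ω k then 1 - θ k else θ k) ∧ (if ω k then 1 - θ k else θ k) ≤ 1 := by
    split_ifs <;> constructor <;> linarith
  refine ⟨by linarith, ?_, ?_⟩
  · rw [Left.nonneg_neg_iff]
    exact Real.log_nonpos (by linarith) h3.2
  · exact neg_le_neg (Real.log_le_log hρ h3.1)

lemma prefixMass_eq_exp (hρ : 0 < ρ) (hθ : ∀ k, ρ ≤ θ k ∧ θ k ≤ 1 - ρ) (ω : ℕ → Bool) (n : ℕ) :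
    prefixMass θ ω n = Real.exp (-infoSum θ ω n) := by
  rw [prefixMass, infoSum, ← Finset.sum_neg_distrib, Real.exp_sum]
  refine Finset.prod_congr rfl fun k _ => ?_
  rw [neg_neg, Real.exp_log (letter_bounds hρ hθ ω k).1]

lemma infoSum_mono (hρ : 0 < ρ) (hθ : ∀ k, ρ ≤ θ k ∧ θ k ≤ 1 - ρ) (ω : ℕ → Bool) :
    Monotone (infoSum θ ω) := by
  refine monotone_nat_of_le_succ fun n => ?_
  rw [infoSum_succ]
  linarith [(letter_bounds hρ hθ ω n).2.1]

lemma infoSum_add_le (hρ : 0 < ρ) (hθ : ∀ k, ρ ≤ θ k ∧ θ k ≤ 1 - ρ) (ω : ℕ → Bool) (n j : ℕ) :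
    infoSum θ ω (n + j) ≤ infoSum θ ω n + j * -Real.log ρ := by
  induction j with
  | zero => simp
  | succ j ih =>
    rw [← add_assoc, infoSum_succ]
    push_cast
    linarith [(letter_bounds hρ hθ ω (n + j)).2.2]

lemma infoSum_bounds (hρ : 0 < ρ) (hθ : ∀ k, ρ ≤ θ k ∧ θ k ≤ 1 - ρ) (ω : ℕ → Bool) (n : ℕ) :
    0 ≤ infoSum θ ω n ∧ infoSum θ ω n ≤ n * -Real.log ρ := by
  have h1 := infoSum_mono hρ hθ ω (Nat.zero_le n)
  have h2 := infoSum_add_le hρ hθ ω 0 n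
  simp [infoSum] at h1 h2 ⊢
  exact ⟨h1, h2⟩

end Info

lemma liminf_eq_iff_of_bdd {ι : Type*} {F : Filter ι} [F.NeBot] {f : ι → ℝ} {b : ℝ}
    (hf : ∀ᶠ i in F, |f i| ≤ b) (α : ℝ) : liminf f F = α ↔
      (∀ ε > 0, ∀ᶠ i in F, α - ε ≤ f i) ∧ ∀ ε > 0, ∃ᶠ i in F, f i ≤ α + ε := by
  have hup : F.IsBoundedUnder (· ≤ ·) f := ⟨b, hf.mono fun i hi => (abs_le.1 hi).2⟩
  have hlo : F.IsBoundedUnder (· ≥ ·) f := ⟨-b, hf.mono fun i hi => (abs_le.1 hi).1⟩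
  constructor
  · rintro rfl
    refine ⟨fun ε hε => ?_, fun ε hε => ?_⟩
    · exact (eventually_lt_of_lt_liminf (sub_lt_self _ hε) hlo).mono fun _ h => h.le
    · exact (frequently_lt_of_liminf_lt hup.isCoboundedUnder_ge
        (lt_add_of_pos_right _ hε)).mono fun _ h => h.le
  · rintro ⟨h1, h2⟩
    refine le_antisymm (le_of_forall_pos_le_add fun ε hε => ?_)
      (le_of_forall_pos_le_add fun ε hε => ?_)
    · exact liminf_le_of_frequently_le (h2 ε hε) hlo
    · have := le_liminf_of_le hup.isCoboundedUnder_ge (h1 ε hε)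
      linarith

lemma limsup_eq_iff_of_bdd {ι : Type*} {F : Filter ι} [F.NeBot] {f : ι → ℝ} {b : ℝ}
    (hf : ∀ᶠ i in F, |f i| ≤ b) (α : ℝ) : limsup f F = α ↔
      (∀ ε > 0, ∀ᶠ i in F, f i ≤ α + ε) ∧ ∀ ε > 0, ∃ᶠ i in F, α - ε ≤ f i := by
  have hup : F.IsBoundedUnder (· ≤ ·) f := ⟨b, hf.mono fun i hi => (abs_le.1 hi).2⟩
  have hlo : F.IsBoundedUnder (· ≥ ·) f := ⟨-b, hf.mono fun i hi => (abs_le.1 hi).1⟩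
  constructor
  · rintro rfl
    refine ⟨fun ε hε => ?_, fun ε hε => ?_⟩
    · exact (eventually_lt_of_limsup_lt (lt_add_of_pos_right _ hε) hup).mono fun _ h => h.le
    · exact (frequently_lt_of_lt_limsup hlo.isCoboundedUnder_le
        (sub_lt_self _ hε)).mono fun _ h => h.le
  · rintro ⟨h1, h2⟩
    refine le_antisymm (le_of_forall_pos_le_add fun ε hε => ?_)
      (le_of_forall_pos_le_add fun ε hε => ?_)
    · exact limsup_le_of_le hlo.isCoboundedUnder_le (h1 ε hε)
    · have := le_limsup_of_frequently_le (h2 ε hε) hup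
      linarith

lemma abs_quotient_sub_le {m u l v C β : ℝ} (hl : 0 < l) (hu0 : 0 ≤ u) (huC : u ≤ C)
    (hv0 : 0 ≤ v) (hvC : v ≤ C) (hm0 : 0 ≤ m) (hm : m ≤ β * l) :
    |-(m + u) / -(l + v) - m / l| ≤ C * (1 + β) / l := by
  have hlv : 0 < l + v := by linarith
  rw [neg_div_neg_eq, div_sub_div _ _ hlv.ne' hl.ne', abs_div,
    abs_of_pos (mul_pos hlv hl), div_le_div_iff₀ (mul_pos hlv hl) hl]
  have hC0 : 0 ≤ C := hu0.trans huC
  have h1 : 0 ≤ u * l := mul_nonneg hu0 hl.le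
  have h2 : 0 ≤ v * m := mul_nonneg hv0 hm0
  have h3 : u * l ≤ C * l := mul_le_mul_of_nonneg_right huC hl.le
  have h4 : v * m ≤ C * (β * l) := mul_le_mul hvC hm hm0 hC0
  have h5 : 0 ≤ C * (β * l) := h2.trans h4
  have h6 : 0 ≤ C * l := h1.trans h3
  have key : |(m + u) * l - (l + v) * m| ≤ C * (1 + β) * l := by
    rw [show (m + u) * l - (l + v) * m = u * l - v * m by ring,
      show C * (1 + β) * l = C * l + C * (β * l) by ring, abs_le]
    constructor <;> linarith
  have h7 : 0 ≤ C * (1 + β) * l := (abs_nonneg _).trans key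
  calc |(m + u) * l - (l + v) * m| * l ≤ C * (1 + β) * l * l :=
        mul_le_mul_of_nonneg_right key hl.le
    _ ≤ C * (1 + β) * l * (l + v) := mul_le_mul_of_nonneg_left (by linarith) h7
    _ = C * (1 + β) * ((l + v) * l) := by ring

section Balls

variable {c r : ℕ → ℝ} {A B ρ : ℝ} {μ : Measure ℝ}

lemma measure_cell (hμ : ∀ w : List Bool, μ (moranI c w) = ENNReal.ofReal (cylMass r w 1 1))
    (ω : ℕ → Bool) (n : ℕ) :
    μ (cell c ω n) = ENNReal.ofReal (prefixMass (fun k => r (k + 1)) ω n) := by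
  rw [← moranI_pref, hμ, cylMass_pref]

lemma prefixMass_congr {θ : ℕ → ℝ} {ω ω' : ℕ → Bool} {n : ℕ} (h : ∀ k < n, ω k = ω' k) :
    prefixMass θ ω n = prefixMass θ ω' n :=
  Finset.prod_congr rfl fun k hk => by rw [h k (Finset.mem_range.1 hk)]

/-- The Moran measure does not charge the complement of the Moran set. -/
lemma measure_compl_moranSet [IsProbabilityMeasure μ] (hB : 2 < B) (hc : ∀ k, B ≤ c (k + 1))
    (hρ : 0 < ρ) (hr : ∀ k, ρ ≤ r (k + 1) ∧ r (k + 1) ≤ 1 - ρ)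
    (hμ : ∀ w : List Bool, μ (moranI c w) = ENNReal.ofReal (cylMass r w 1 1)) :
    μ (moranSet c)ᶜ = 0 := by
  set θ : ℕ → ℝ := fun k => r (k + 1) with hθdef
  have hsplit : ∀ w : List Bool, ∀ᵐ x ∂μ, x ∈ moranI c w →
      ∃ b : Bool, x ∈ moranI c (w ++ [b]) := by
    intro w
    obtain ⟨ω, hω⟩ := exists_pref_eq w
    set n := w.length
    let e : Bool → ℕ → Bool := fun b => Function.update ω n b
    have hag : ∀ b, ∀ k < n, e b k = ω k := fun b k hk => Function.update_of_ne hk.ne _ _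
    have hw : ∀ b, w ++ [b] = pref (e b) (n + 1) := fun b => by
      rw [pref_succ, pref_eq_iff.2 (hag b), hω]; simp [e]
    have hI : ∀ b, moranI c (w ++ [b]) = cell c (e b) (n + 1) := fun b => by
      rw [hw, moranI_pref]
    have hI0 : moranI c w = cell c ω n := by rw [← moranI_pref, hω]
    have hsub : ∀ b, cell c (e b) (n + 1) ⊆ cell c ω n := fun b =>
      (cell_succ_subset hB hc _ n).trans (cell_congr (hag b)).subset
    have hdisj : Disjoint (cell c (e false) (n + 1)) (cell c (e true) (n + 1)) := by
      rw [Set.disjoint_left]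
      intro x hx hy
      have := agree_of_mem_cell hB hc hx hy n n.lt_succ_self
      simp [e] at this
    have hm : ∀ b, MeasurableSet (cell c (e b) (n + 1)) := fun b => measurableSet_Icc
    have hmass : ∀ b, prefixMass θ (e b) (n + 1) =
        prefixMass θ ω n * if b then 1 - θ n else θ n := fun b => by
      rw [prefixMass_succ, prefixMass_congr (hag b)]; simp [e]
    have hpos : 0 ≤ prefixMass θ ω n := by rw [prefixMass_eq_exp hρ hr]; positivity
    have hsum : μ (cell c (e false) (n + 1) ∪ cell c (e true) (n + 1)) = μ (cell c ω n) := by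
      rw [measure_union hdisj (hm true), measure_cell hμ, measure_cell hμ, measure_cell hμ,
        ← hθdef, ← ENNReal.ofReal_add]
      · congr 1
        rw [hmass, hmass]; simp; ring
      all_goals rw [prefixMass_eq_exp hρ hr]; positivity
    have hdiff : μ (cell c ω n \ (cell c (e false) (n + 1) ∪ cell c (e true) (n + 1))) = 0 := by
      rw [measure_sdiff (union_subset (hsub _) (hsub _)) ((hm _).union (hm _)).nullMeasurableSet
        (measure_ne_top _ _), hsum, tsub_self]
    have := measure_eq_zero_iff_ae_notMem.1 hdiff
    filter_upwards [this] with x hx hxw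
    rw [hI0] at hxw
    simp only [Set.mem_sdiff, hxw, true_and, not_not] at hx
    rcases hx with h | h
    · exact ⟨false, by rwa [hI]⟩
    · exact ⟨true, by rwa [hI]⟩
  have h0 : ∀ᵐ x ∂μ, x ∈ moranI c [] := by
    have : μ (moranI c []) = 1 := by rw [hμ]; simp [cylMass]
    exact (prob_compl_eq_zero_iff measurableSet_Icc).2 this
  rw [measure_eq_zero_iff_ae_notMem]
  filter_upwards [h0, ae_all_iff.2 hsplit] with x hx hs
  simp only [mem_compl_iff, not_not, moranSet, mem_iInter, mem_iUnion, mem_ofPred_eq]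
  intro n
  induction n with
  | zero => exact ⟨[], rfl, hx⟩
  | succ n ih =>
    obtain ⟨w, hw, hxw⟩ := ih
    obtain ⟨b, hb⟩ := hs w hxw
    exact ⟨w ++ [b], by simp [hw], hb⟩

lemma measure_ball_le [IsProbabilityMeasure μ] (hB : 2 < B) (hc : ∀ k, B ≤ c (k + 1))
    (hρ : 0 < ρ) (hr : ∀ k, ρ ≤ r (k + 1) ∧ r (k + 1) ≤ 1 - ρ)
    (hμ : ∀ w : List Bool, μ (moranI c w) = ENNReal.ofReal (cylMass r w 1 1))
    {x t : ℝ} {ω : ℕ → Bool} (hx : ∀ n, x ∈ cell c ω n) {n : ℕ}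
    (ht : t < (1 - 2 / B) * levelLen c n) :
    μ (closedBall x t) ≤ ENNReal.ofReal (prefixMass (fun k => r (k + 1)) ω n) := by
  rw [← measure_cell hμ, ← measure_inter_conull (measure_compl_moranSet hB hc hρ hr hμ)]
  refine measure_mono fun y hy => ?_
  obtain ⟨ω', hω'⟩ := exists_coding hB hc hy.2
  by_cases h : ∀ k < n, ω k = ω' k
  · rw [cell_congr h]; exact hω' n
  · have h1 := le_dist_of_mem_cell hB hc h (hx n) (hω' n)
    have h2 := hy.1
    rw [mem_closedBall, Real.dist_eq, abs_sub_comm] at h2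
    linarith

lemma le_measure_ball (hμ : ∀ w : List Bool, μ (moranI c w) = ENNReal.ofReal (cylMass r w 1 1))
    {x t : ℝ} {ω : ℕ → Bool} (hx : ∀ n, x ∈ cell c ω n) {n : ℕ} (ht : levelLen c n ≤ t) :
    ENNReal.ofReal (prefixMass (fun k => r (k + 1)) ω n) ≤ μ (closedBall x t) := by
  rw [← measure_cell hμ]
  refine measure_mono fun y hy => ?_
  have h1 := hx n
  rw [cell, mem_Icc] at h1 hy
  rw [mem_closedBall, Real.dist_eq, abs_le]
  constructor <;> linarith

lemma logScale_succ (c : ℕ → ℝ) (n : ℕ) :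
    logScale c (n + 1) = logScale c n + Real.log (c (n + 1)) := by
  rw [logScale, Finset.sum_range_succ, ← logScale]

lemma logScale_pos (hB : 2 < B) (hc : ∀ k, B ≤ c (k + 1)) {n : ℕ} (hn : n ≠ 0) :
    0 < logScale c n :=
  Finset.sum_pos (fun k _ => Real.log_pos (by linarith [hc k])) (by simpa using hn)

lemma tendsto_logScale (hB : 2 < B) (hc : ∀ k, B ≤ c (k + 1)) (hcA : ∀ k, c (k + 1) ≤ A) :
    Tendsto (logScale c) atTop atTop :=
  tendsto_atTop_mono (fun n => (logScale_mono_bounds hB hc hcA n).1)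
    (tendsto_natCast_atTop_atTop.atTop_mul_const (Real.log_pos (by linarith)))

set_option maxHeartbeats 1000000 in
/-- At comparable scales the quotient defining the local dimension is close to the quotient
computed on basic intervals. -/
lemma exists_local_quotient_bound [IsProbabilityMeasure μ] (hB : 2 < B)
    (hc : ∀ k, B ≤ c (k + 1)) (hcA : ∀ k, c (k + 1) ≤ A)
    (hρ : 0 < ρ) (hr : ∀ k, ρ ≤ r (k + 1) ∧ r (k + 1) ≤ 1 - ρ)
    (hμ : ∀ w : List Bool, μ (moranI c w) = ENNReal.ofReal (cylMass r w 1 1))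
    {x : ℝ} {ω : ℕ → Bool} (hx : ∀ n, x ∈ cell c ω n) :
    ∃ C : ℝ, ∀ n ≠ 0, ∀ t : ℝ, (1 - 2 / B) * levelLen c (n + 1) ≤ t →
      t < (1 - 2 / B) * levelLen c n →
      |Real.log (μ (closedBall x t)).toReal / Real.log t -
        infoSum (fun k => r (k + 1)) ω n / logScale c n| ≤ C / logScale c n := by
  set κ := 1 - 2 / B with hκdef
  have hκ : 0 < κ := by
    rw [hκdef, sub_pos, div_lt_one (by linarith)]; exact hB
  have hκ1 : κ < 1 := by
    have : 0 < 2 / B := by positivity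
    linarith
  set θ : ℕ → ℝ := fun k => r (k + 1) with hθdef
  have hBi : B⁻¹ < 1 := inv_lt_one_of_one_lt₀ (by linarith)
  obtain ⟨K, hK⟩ := exists_pow_lt_of_lt_one hκ hBi
  have hBi0 : 0 < B⁻¹ := by positivity
  have hlenK : ∀ n j, levelLen c (n + j) ≤ levelLen c n * B⁻¹ ^ j := by
    intro n j
    induction j with
    | zero => simp
    | succ j ih =>
      rw [← add_assoc, pow_succ, ← mul_assoc]
      exact (levelLen_succ_le hB hc _).trans (mul_le_mul_of_nonneg_right ih hBi0.le)
  set b := -Real.log ρ with hb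
  have hb0 : 0 ≤ b := by
    have := letter_bounds hρ hr ω 0
    linarith [this.2.1, this.2.2]
  have hlB : 0 < Real.log B := Real.log_pos (by linarith)
  have hlA : 0 < Real.log A := Real.log_pos (by linarith [hc 0, hcA 0])
  set C := (K + 1) * b + Real.log A - Real.log κ with hC
  have hlκ : Real.log κ < 0 := Real.log_neg hκ hκ1
  have hC0 : 0 ≤ C := by
    have : 0 ≤ (K + 1) * b := by positivity
    linarith
  refine ⟨C * (1 + b / Real.log B), fun n hn t ht1 ht2 => ?_⟩
  have hl := logScale_pos hB hc hn
  have hlen := levelLen_pos hB hc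
  have ht0 : 0 < t := lt_of_lt_of_le (mul_pos hκ (hlen _)) ht1
  have hle : levelLen c (n + 1 + K) ≤ t := by
    refine (hlenK _ _).trans (le_trans ?_ ht1)
    rw [mul_comm]
    exact mul_le_mul_of_nonneg_right hK.le (hlen _).le
  have hU1 := le_measure_ball hμ hx hle
  have hU2 := measure_ball_le hB hc hρ hr hμ hx ht2
  rw [← hθdef, prefixMass_eq_exp hρ hr] at hU1 hU2
  rw [ENNReal.ofReal_le_iff_le_toReal (measure_ne_top _ _)] at hU1
  have hU3 := ENNReal.toReal_le_of_le_ofReal (Real.exp_pos _).le hU2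
  set M := (μ (closedBall x t)).toReal with hM
  have hM0 : 0 < M := lt_of_lt_of_le (Real.exp_pos _) hU1
  have hL1 := (Real.le_log_iff_exp_le hM0).2 hU1
  have hL2 := (Real.log_le_iff_le_exp hM0).2 hU3
  have hm := infoSum_add_le hρ hr ω n (1 + K)
  rw [← add_assoc] at hm
  push_cast at hm
  have hT1 : Real.log κ - logScale c (n + 1) ≤ Real.log t := by
    rw [sub_eq_add_neg, ← Real.log_exp (-logScale c (n + 1)), ← levelLen_eq_exp hB hc,
      ← Real.log_mul hκ.ne' (hlen _).ne']
    exact Real.log_le_log (mul_pos hκ (hlen _)) ht1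
  have hT2 : Real.log t ≤ Real.log κ - logScale c n := by
    rw [sub_eq_add_neg, ← Real.log_exp (-logScale c n), ← levelLen_eq_exp hB hc,
      ← Real.log_mul hκ.ne' (hlen _).ne']
    exact Real.log_le_log ht0 ht2.le
  rw [logScale_succ] at hT1
  have hcl : Real.log (c (n + 1)) ≤ Real.log A := Real.log_le_log (by linarith [hc n]) (hcA n)
  set m := infoSum θ ω n with hmdef
  set l := logScale c n with hldef
  have hmb : 0 ≤ m ∧ m ≤ b / Real.log B * l := by
    have h1 := infoSum_bounds hρ hr ω n
    refine ⟨h1.1, h1.2.trans ?_⟩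
    rw [div_mul_eq_mul_div, le_div_iff₀ hlB]
    have := mul_le_mul_of_nonneg_left (logScale_mono_bounds hB hc hcA n).1 hb0
    linarith
  obtain ⟨u, hu⟩ : ∃ u, Real.log M = -(m + u) := ⟨-Real.log M - m, by ring⟩
  obtain ⟨v, hv⟩ : ∃ v, Real.log t = -(l + v) := ⟨-Real.log t - l, by ring⟩
  rw [hu] at hL1 hL2
  rw [hv] at hT1 hT2
  have hu0 : 0 ≤ u := by linarith
  have huC : u ≤ C := by linarith
  have hv0 : 0 ≤ v := by linarith
  have hvC : v ≤ C := by
    have : 0 ≤ (K + 1) * b := by positivity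
    linarith
  rw [hu, hv]
  exact abs_quotient_sub_le hl hu0 huC hv0 hvC hmb.1 hmb.2

end Balls

section Transfer

variable {ι : Type*} {F : Filter ι} {N : ι → ℕ} {f : ι → ℝ} {a : ℕ → ℝ}

lemma liminf_eq_iff_of_map [F.NeBot] (hN : map N F = atTop)
    (hfa : ∀ ε > 0, ∀ᶠ t in F, |f t - a (N t)| ≤ ε) {b : ℝ} (ha : ∀ n, |a n| ≤ b) (α : ℝ) :
    liminf f F = α ↔
      (∀ ε > 0, ∀ᶠ n in atTop, α - ε ≤ a n) ∧ ∀ ε > 0, ∃ᶠ n in atTop, a n ≤ α + ε := by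
  have hf : ∀ᶠ t in F, |f t| ≤ b + 1 := (hfa 1 one_pos).mono fun t ht => by
    have := abs_add_le (f t - a (N t)) (a (N t))
    rw [sub_add_cancel] at this
    linarith [ha (N t)]
  rw [liminf_eq_iff_of_bdd hf, ← hN]
  simp only [eventually_map, frequently_map]
  constructor
  · rintro ⟨h1, h2⟩
    refine ⟨fun ε hε => ?_, fun ε hε => ?_⟩
    · filter_upwards [h1 (ε / 2) (half_pos hε), hfa (ε / 2) (half_pos hε)] with t h3 h4
      linarith [(abs_le.1 h4).2]
    · refine ((h2 (ε / 2) (half_pos hε)).and_eventually (hfa (ε / 2) (half_pos hε))).mono ?_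
      rintro t ⟨h3, h4⟩
      linarith [(abs_le.1 h4).1]
  · rintro ⟨h1, h2⟩
    refine ⟨fun ε hε => ?_, fun ε hε => ?_⟩
    · filter_upwards [h1 (ε / 2) (half_pos hε), hfa (ε / 2) (half_pos hε)] with t h3 h4
      linarith [(abs_le.1 h4).1]
    · refine ((h2 (ε / 2) (half_pos hε)).and_eventually (hfa (ε / 2) (half_pos hε))).mono ?_
      rintro t ⟨h3, h4⟩
      linarith [(abs_le.1 h4).2]

lemma limsup_eq_iff_of_map [F.NeBot] (hN : map N F = atTop)
    (hfa : ∀ ε > 0, ∀ᶠ t in F, |f t - a (N t)| ≤ ε) {b : ℝ} (ha : ∀ n, |a n| ≤ b) (α : ℝ) :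
    limsup f F = α ↔
      (∀ ε > 0, ∀ᶠ n in atTop, a n ≤ α + ε) ∧ ∀ ε > 0, ∃ᶠ n in atTop, α - ε ≤ a n := by
  have hf : ∀ᶠ t in F, |f t| ≤ b + 1 := (hfa 1 one_pos).mono fun t ht => by
    have := abs_add_le (f t - a (N t)) (a (N t))
    rw [sub_add_cancel] at this
    linarith [ha (N t)]
  rw [limsup_eq_iff_of_bdd hf, ← hN]
  simp only [eventually_map, frequently_map]
  constructor
  · rintro ⟨h1, h2⟩
    refine ⟨fun ε hε => ?_, fun ε hε => ?_⟩
    · filter_upwards [h1 (ε / 2) (half_pos hε), hfa (ε / 2) (half_pos hε)] with t h3 h4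
      linarith [(abs_le.1 h4).1]
    · refine ((h2 (ε / 2) (half_pos hε)).and_eventually (hfa (ε / 2) (half_pos hε))).mono ?_
      rintro t ⟨h3, h4⟩
      linarith [(abs_le.1 h4).2]
  · rintro ⟨h1, h2⟩
    refine ⟨fun ε hε => ?_, fun ε hε => ?_⟩
    · filter_upwards [h1 (ε / 2) (half_pos hε), hfa (ε / 2) (half_pos hε)] with t h3 h4
      linarith [(abs_le.1 h4).2]
    · refine ((h2 (ε / 2) (half_pos hε)).and_eventually (hfa (ε / 2) (half_pos hε))).mono ?_
      rintro t ⟨h3, h4⟩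
      linarith [(abs_le.1 h4).1]

end Transfer

/-- A level function for a positive strictly decreasing null sequence of scales. -/
lemma exists_level_map {s : ℕ → ℝ} (hs : StrictAnti s) (hpos : ∀ n, 0 < s n)
    (hlim : Tendsto s atTop (𝓝 0)) :
    ∃ N : ℝ → ℕ, map N (𝓝[>] 0) = atTop ∧
      ∀ᶠ t in 𝓝[>] 0, s (N t + 1) ≤ t ∧ t < s (N t) := by
  classical
  have hne : ∀ t : ℝ, 0 < t → {n | s (n + 1) ≤ t}.Nonempty := fun t ht =>
    (((tendsto_add_atTop_iff_nat 1).2 hlim).eventually_le_const ht).exists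
  let N : ℝ → ℕ := fun t => sInf {n | s (n + 1) ≤ t}
  have hN1 : ∀ t, 0 < t → s (N t + 1) ≤ t := fun t ht => Nat.sInf_mem (hne t ht)
  have hN2 : ∀ t n, 0 < t → t < s n → n ≤ N t := by
    intro t n ht hn
    by_contra hlt
    have := hs.antitone (Nat.succ_le_of_lt (not_le.1 hlt))
    have h1 := hN1 t ht
    simp only [Nat.succ_eq_add_one] at this
    linarith
  have hN3 : ∀ n, N (s (n + 1)) = n := by
    intro n
    refine le_antisymm (Nat.sInf_le (by simp)) ?_
    exact hN2 _ _ (hpos _) (hs n.lt_succ_self)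
  have hev : ∀ n, ∀ᶠ t in 𝓝[>] (0 : ℝ), 0 < t ∧ t < s n := fun n =>
    Ioo_mem_nhdsGT (hpos n)
  have htend : Tendsto N (𝓝[>] 0) atTop :=
    tendsto_atTop.2 fun n => (hev n).mono fun t ht => hN2 t n ht.1 ht.2
  refine ⟨N, le_antisymm htend ?_, ?_⟩
  · have h1 : Tendsto (fun n => s (n + 1)) atTop (𝓝[>] 0) :=
      tendsto_nhdsWithin_iff.2 ⟨(tendsto_add_atTop_iff_nat 1).2 hlim,
        Eventually.of_forall fun n => hpos _⟩
    have h2 := Filter.map_mono (m := N) h1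
    rw [Filter.map_map] at h2
    have h3 : N ∘ (fun n => s (n + 1)) = id := funext hN3
    rwa [h3, Filter.map_id] at h2
  · filter_upwards [hev 1] with t ht
    refine ⟨hN1 t ht.1, ?_⟩
    have h1 := hN2 t 1 ht.1 ht.2
    by_contra hle
    have h2 : N t - 1 ∈ {n | s (n + 1) ≤ t} := by
      simp only [mem_ofPred_eq, Nat.sub_add_cancel h1]
      exact not_lt.1 hle
    have := Nat.sInf_le h2
    change N t ≤ N t - 1 at this
    omega

section LocalDim

variable {c r : ℕ → ℝ} {A B ρ : ℝ} {μ : Measure ℝ}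

lemma exists_local_transfer [IsProbabilityMeasure μ] (hB : 2 < B)
    (hc : ∀ k, B ≤ c (k + 1)) (hcA : ∀ k, c (k + 1) ≤ A)
    (hρ : 0 < ρ) (hr : ∀ k, ρ ≤ r (k + 1) ∧ r (k + 1) ≤ 1 - ρ)
    (hμ : ∀ w : List Bool, μ (moranI c w) = ENNReal.ofReal (cylMass r w 1 1))
    {x : ℝ} {ω : ℕ → Bool} (hx : ∀ n, x ∈ cell c ω n) :
    ∃ N : ℝ → ℕ, map N (𝓝[>] 0) = atTop ∧ ∀ ε > 0, ∀ᶠ t in 𝓝[>] (0 : ℝ),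
      |Real.log (μ (closedBall x t)).toReal / Real.log t -
        infoSum (fun k => r (k + 1)) ω (N t) / logScale c (N t)| ≤ ε := by
  obtain ⟨C, hC⟩ := exists_local_quotient_bound hB hc hcA hρ hr hμ hx
  have hκ : 0 < 1 - 2 / B := by
    rw [sub_pos, div_lt_one (by linarith)]; exact hB
  have hanti : StrictAnti fun n => (1 - 2 / B) * levelLen c n := by
    refine strictAnti_nat_of_succ_lt fun n => mul_lt_mul_of_pos_left ?_ hκ
    refine (levelLen_succ_le hB hc n).trans_lt ?_
    exact mul_lt_of_lt_one_right (levelLen_pos hB hc n) (inv_lt_one_of_one_lt₀ (by linarith))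
  obtain ⟨N, hN, hNt⟩ := exists_level_map hanti (fun n => mul_pos hκ (levelLen_pos hB hc n))
    (by simpa using (tendsto_levelLen hB hc).const_mul (1 - 2 / B))
  refine ⟨N, hN, fun ε hε => ?_⟩
  have h1 : ∀ᶠ n in atTop, n ≠ 0 ∧ C / logScale c n ≤ ε :=
    (eventually_ne_atTop 0).and
      (((tendsto_logScale hB hc hcA).const_div_atTop C).eventually_le_const hε)
  rw [← hN, eventually_map] at h1
  filter_upwards [h1, hNt] with t h2 h3
  exact (hC _ h2.1 t h3.1 h3.2).trans h2.2

lemma abs_infoSum_div_le (hB : 2 < B) (hc : ∀ k, B ≤ c (k + 1)) (hcA : ∀ k, c (k + 1) ≤ A)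
    {θ : ℕ → ℝ} (hρ : 0 < ρ) (hθ : ∀ k, ρ ≤ θ k ∧ θ k ≤ 1 - ρ) (ω : ℕ → Bool) (n : ℕ) :
    |infoSum θ ω n / logScale c n| ≤ -Real.log ρ / Real.log B := by
  have hb : 0 ≤ -Real.log ρ := by
    have := letter_bounds hρ hθ ω 0
    linarith [this.2.1, this.2.2]
  have hlB : 0 < Real.log B := Real.log_pos (by linarith)
  have h1 := infoSum_bounds hρ hθ ω n
  have h2 := (logScale_mono_bounds hB hc hcA n).1
  rcases eq_or_ne n 0 with rfl | hn
  · simp [logScale]; positivity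
  have h3 := logScale_pos hB hc hn
  rw [abs_of_nonneg (div_nonneg h1.1 h3.le), div_le_div_iff₀ h3 hlB]
  calc infoSum θ ω n * Real.log B ≤ n * -Real.log ρ * Real.log B :=
        mul_le_mul_of_nonneg_right h1.2 hlB.le
    _ = -Real.log ρ * (n * Real.log B) := by ring
    _ ≤ _ := mul_le_mul_of_nonneg_left h2 hb

lemma lowerLocalDim_eq_iff [IsProbabilityMeasure μ] (hB : 2 < B)
    (hc : ∀ k, B ≤ c (k + 1)) (hcA : ∀ k, c (k + 1) ≤ A)
    (hρ : 0 < ρ) (hr : ∀ k, ρ ≤ r (k + 1) ∧ r (k + 1) ≤ 1 - ρ)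
    (hμ : ∀ w : List Bool, μ (moranI c w) = ENNReal.ofReal (cylMass r w 1 1))
    {x : ℝ} {ω : ℕ → Bool} (hx : ∀ n, x ∈ cell c ω n) (α : ℝ) :
    lowerLocalDim μ x = α ↔
      (∀ ε > 0, ∀ᶠ n in atTop, (α - ε) * logScale c n ≤ infoSum (fun k => r (k + 1)) ω n) ∧
      ∀ ε > 0, ∃ᶠ n in atTop, infoSum (fun k => r (k + 1)) ω n ≤ (α + ε) * logScale c n := by
  obtain ⟨N, hN, hf⟩ := exists_local_transfer hB hc hcA hρ hr hμ hx
  have h := liminf_eq_iff_of_map hN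
    (a := fun n => infoSum (fun k => r (k + 1)) ω n / logScale c n) hf
    (abs_infoSum_div_le hB hc hcA hρ hr ω) α
  rw [lowerLocalDim, h]
  have hpos : ∀ᶠ n in atTop, 0 < logScale c n :=
    (eventually_ne_atTop 0).mono fun n hn => logScale_pos hB hc hn
  refine and_congr (forall₂_congr fun ε _ => ?_) (forall₂_congr fun ε _ => ?_)
  · exact eventually_congr (hpos.mono fun n hn => le_div_iff₀ hn)
  · exact frequently_congr (hpos.mono fun n hn => div_le_iff₀ hn)

lemma upperLocalDim_eq_iff [IsProbabilityMeasure μ] (hB : 2 < B)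
    (hc : ∀ k, B ≤ c (k + 1)) (hcA : ∀ k, c (k + 1) ≤ A)
    (hρ : 0 < ρ) (hr : ∀ k, ρ ≤ r (k + 1) ∧ r (k + 1) ≤ 1 - ρ)
    (hμ : ∀ w : List Bool, μ (moranI c w) = ENNReal.ofReal (cylMass r w 1 1))
    {x : ℝ} {ω : ℕ → Bool} (hx : ∀ n, x ∈ cell c ω n) (α : ℝ) :
    upperLocalDim μ x = α ↔
      (∀ ε > 0, ∀ᶠ n in atTop, infoSum (fun k => r (k + 1)) ω n ≤ (α + ε) * logScale c n) ∧
      ∀ ε > 0, ∃ᶠ n in atTop, (α - ε) * logScale c n ≤ infoSum (fun k => r (k + 1)) ω n := by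
  obtain ⟨N, hN, hf⟩ := exists_local_transfer hB hc hcA hρ hr hμ hx
  have h := limsup_eq_iff_of_map hN
    (a := fun n => infoSum (fun k => r (k + 1)) ω n / logScale c n) hf
    (abs_infoSum_div_le hB hc hcA hρ hr ω) α
  rw [upperLocalDim, h]
  have hpos : ∀ᶠ n in atTop, 0 < logScale c n :=
    (eventually_ne_atTop 0).mono fun n hn => logScale_pos hB hc hn
  refine and_congr (forall₂_congr fun ε _ => ?_) (forall₂_congr fun ε _ => ?_)
  · exact eventually_congr (hpos.mono fun n hn => div_le_iff₀ hn)
  · exact frequently_congr (hpos.mono fun n hn => le_div_iff₀ hn)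

end LocalDim

/-- The law on `Bool` giving weight `t` to `false`, for `t ∈ [0,1]`. -/
noncomputable def letterLaw (t : unitInterval) : Measure Bool :=
  ENNReal.ofReal t • Measure.dirac false + ENNReal.ofReal (1 - t) • Measure.dirac true

instance (t : unitInterval) : IsProbabilityMeasure (letterLaw t) := by
  constructor
  have h0 := t.2.1
  have h1 : 0 ≤ 1 - (t : ℝ) := by linarith [t.2.2]
  simp [letterLaw, ← ENNReal.ofReal_add h0 h1]

lemma letterLaw_singleton (t : unitInterval) (b : Bool) :
    letterLaw t {b} = ENNReal.ofReal (if b then 1 - t else t) := by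
  cases b <;> simp [letterLaw]

lemma integral_letterLaw (t : unitInterval) (g : Bool → ℝ) :
    ∫ b, g b ∂letterLaw t = t * g false + (1 - t) * g true := by
  have h0 := t.2.1
  have h1 : 0 ≤ 1 - (t : ℝ) := by linarith [t.2.2]
  rw [integral_fintype (Integrable.of_finite), Fintype.sum_bool]
  simp only [Measure.real, letterLaw_singleton]
  simp [ENNReal.toReal_ofReal, h0, h1]
  ring

open ProbabilityTheory in
lemma ae_eventually_sum_lt (t : ℕ → unitInterval) {g : ℕ → Bool → ℝ} {C : ℝ} (hC : 0 < C)
    (hg : ∀ k b, |g k b| ≤ C) {ε : ℝ} (hε : 0 < ε) :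
    ∀ᵐ ω ∂Measure.infinitePi (fun k => letterLaw (t k)), ∀ᶠ n : ℕ in atTop,
      ∑ k ∈ Finset.range n, (g k (ω k) - (t k * g k false + (1 - t k) * g k true)) < ε * n := by
  set P := Measure.infinitePi (fun k => letterLaw (t k)) with hP
  have hmeas : ∀ k, Measurable (g k) := fun k => measurable_of_countable _
  have hmean : ∀ k, ∫ ω, g k (ω k) ∂P = t k * g k false + (1 - t k) * g k true := by
    intro k
    rw [← integral_letterLaw, ← Measure.infinitePi_map_eval (fun k => letterLaw (t k)) k,
      integral_map (measurable_pi_apply k).aemeasurable (hmeas k).aestronglyMeasurable]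
  set X : ℕ → (ℕ → Bool) → ℝ := fun k ω =>
    g k (ω k) - (t k * g k false + (1 - t k) * g k true) with hX
  have hind : iIndepFun X P := iIndepFun_infinitePi
    (X := fun k b => g k b - (t k * g k false + (1 - t k) * g k true))
    fun k => measurable_of_countable _
  have hsub : ∀ k, HasSubgaussianMGF (X k) ((‖C - -C‖₊ / 2) ^ 2) P := by
    intro k
    have := hasSubgaussianMGF_of_mem_Icc (μ := P) (X := fun ω => g k (ω k)) (a := -C) (b := C)
      ((hmeas k).comp (measurable_pi_apply k)).aemeasurable
      (Eventually.of_forall fun ω => abs_le.1 (hg k (ω k)))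
    rwa [hmean] at this
  have hcst : ((((‖C - -C‖₊ / 2) ^ 2 : NNReal)) : ℝ) = C ^ 2 := by
    push_cast
    rw [show C - -C = 2 * C by ring, Real.norm_of_nonneg (by linarith)]
    ring
  set s : ℕ → Set (ℕ → Bool) := fun n => {ω | ε * n ≤ ∑ k ∈ Finset.range n, X k ω} with hs
  have hle : ∀ n, P.real (s n) ≤ Real.exp (-(ε ^ 2 / (2 * C ^ 2))) ^ n := by
    intro n
    refine (HasSubgaussianMGF.measure_sum_range_ge_le_of_iIndepFun hind (fun k _ => hsub k)
      (by positivity)).trans (le_of_eq ?_)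
    rw [hcst, ← Real.exp_nat_mul]
    congr 1
    rcases eq_or_ne n 0 with rfl | hn
    · simp
    · field_simp
  have hsum : ∑' n, P (s n) ≠ ⊤ := by
    have h1 : ∀ n, P (s n) ≤ ENNReal.ofReal (Real.exp (-(ε ^ 2 / (2 * C ^ 2))) ^ n) := by
      intro n
      rw [← ofReal_measureReal]
      exact ENNReal.ofReal_le_ofReal (hle n)
    refine ne_top_of_le_ne_top ?_ (ENNReal.tsum_le_tsum h1)
    refine (summable_geometric_of_lt_one (Real.exp_pos _).le ?_).tsum_ofReal_ne_top
    rw [Real.exp_lt_one_iff]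
    have : 0 < ε ^ 2 / (2 * C ^ 2) := by positivity
    linarith
  filter_upwards [ae_eventually_notMem hsum] with ω hω
  filter_upwards [hω] with n hn
  exact not_le.1 hn

/-- For any sequence of weights in `[0,1]` there is a probability on `{false, true}^ℕ` with
the corresponding cylinder masses, and it satisfies the strong law of large numbers. -/
lemma exists_bernoulli_measure {θ : ℕ → ℝ} (hθ : ∀ k, 0 ≤ θ k ∧ θ k ≤ 1) :
    ∃ P : Measure (ℕ → Bool), IsProbabilityMeasure P ∧
      (∀ ω n, P {ω' | ∀ k < n, ω' k = ω k} = ENNReal.ofReal (prefixMass θ ω n)) ∧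
      ∀ (g : ℕ → Bool → ℝ) (C : ℝ), (∀ k b, |g k b| ≤ C) → ∀ᵐ ω ∂P, ∀ ε > 0,
        ∀ᶠ n : ℕ in atTop, |∑ k ∈ Finset.range n,
          (g k (ω k) - (θ k * g k false + (1 - θ k) * g k true))| ≤ ε * n := by
  let t : ℕ → unitInterval := fun k => ⟨θ k, hθ k⟩
  refine ⟨Measure.infinitePi (fun k => letterLaw (t k)), inferInstance, fun ω n => ?_,
    fun g C hg => ?_⟩
  · have h : {ω' : ℕ → Bool | ∀ k < n, ω' k = ω k} =
        Set.pi (Finset.range n) fun k => {ω k} := by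
      ext ω'; simp
    rw [h, Measure.infinitePi_pi _ fun _ _ => measurableSet_singleton _, prefixMass,
      ENNReal.ofReal_prod_of_nonneg]
    · exact Finset.prod_congr rfl fun k _ => letterLaw_singleton _ _
    · intro k _
      have := hθ k
      split_ifs <;> linarith
  · have hC0 : 0 < |C| + 1 := by positivity
    have hg1 : ∀ k b, |g k b| ≤ |C| + 1 := fun k b =>
      (hg k b).trans ((le_abs_self C).trans (by linarith))
    have hg2 : ∀ k b, |-g k b| ≤ |C| + 1 := fun k b => by rw [abs_neg]; exact hg1 k b
    have h1 := ae_all_iff.2 fun j : ℕ => ae_eventually_sum_lt t hC0 hg1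
      (Nat.one_div_pos_of_nat (n := j) (α := ℝ))
    have h2 := ae_all_iff.2 fun j : ℕ => ae_eventually_sum_lt t (g := fun k b => -g k b) hC0 hg2
      (Nat.one_div_pos_of_nat (n := j) (α := ℝ))
    filter_upwards [h1, h2] with ω h3 h4 ε hε
    obtain ⟨j, hj⟩ := exists_nat_one_div_lt hε
    filter_upwards [h3 j, h4 j] with n h5 h6
    have h7 : 1 / ((j : ℝ) + 1) * n ≤ ε * n := by gcongr
    have h8 : ∑ k ∈ Finset.range n, (-g k (ω k) - ((t k : ℝ) * -g k false +
        (1 - (t k : ℝ)) * -g k true)) = -∑ k ∈ Finset.range n, (g k (ω k) -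
        (θ k * g k false + (1 - θ k) * g k true)) := by
      rw [← Finset.sum_neg_distrib]
      exact Finset.sum_congr rfl fun k _ => by simp only [t]; ring
    rw [h8] at h6
    have h9 : ∑ k ∈ Finset.range n, (g k (ω k) - ((t k : ℝ) * g k false +
        (1 - (t k : ℝ)) * g k true)) = ∑ k ∈ Finset.range n, (g k (ω k) -
        (θ k * g k false + (1 - θ k) * g k true)) := rfl
    rw [h9] at h5
    rw [abs_le]
    constructor <;> linarith

lemma measurableSet_cylinder (ω : ℕ → Bool) (n : ℕ) :
    MeasurableSet {ω' : ℕ → Bool | ∀ k < n, ω' k = ω k} := by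
  have h : {ω' : ℕ → Bool | ∀ k < n, ω' k = ω k} =
      ⋂ k, ⋂ (_ : k < n), (fun ω' : ℕ → Bool => ω' k) ⁻¹' {ω k} := by
    ext ω'; simp
  rw [h]
  exact MeasurableSet.iInter fun k => MeasurableSet.iInter fun _ =>
    measurable_pi_apply k (measurableSet_singleton _)

lemma ediam_cell (c : ℕ → ℝ) (ω : ℕ → Bool) (n : ℕ) :
    ediam (cell c ω n) = ENNReal.ofReal (levelLen c n) := by
  rw [cell, Real.ediam_Icc]
  congr 1
  ring

section
variable {A B : ℝ} {c : ℕ → ℝ} {ρ d : ℝ}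

/-- Mass distribution principle, upper bound along frequently occurring scales. -/
lemma dimH_le_of_frequently (hB : 2 < B) (hc : ∀ k, B ≤ c (k + 1))
    {φ : ℕ → ℝ} (hρ : 0 < ρ) (hφ : ∀ k, ρ ≤ φ k ∧ φ k ≤ 1 - ρ) {E : Set ℝ}
    (hE : ∀ x ∈ E, ∃ ω : ℕ → Bool, (∀ n, x ∈ cell c ω n) ∧
      ∀ ε > 0, ∃ᶠ n in atTop, infoSum φ ω n ≤ (d + ε) * logScale c n) :
    dimH E ≤ ENNReal.ofReal d := by
  refine ENNReal.le_of_forall_pos_le_add fun ε hε _ => ?_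
  have hcoe : ENNReal.ofReal d + ε = ((d.toNNReal + ε : NNReal) : ENNReal) := by
    rw [ENNReal.coe_add]; rfl
  rw [hcoe]
  set d' : NNReal := d.toNNReal + ε with hd'
  have hdd' : d + ε ≤ d' := by
    rw [hd']; push_cast; linarith [Real.le_coe_toNNReal d]
  obtain ⟨P, hP, hcyl, -⟩ := exists_bernoulli_measure (θ := φ) fun k =>
    ⟨hρ.le.trans (hφ k).1, (hφ k).2.trans (by linarith)⟩
  choose e he using exists_pref_eq
  let K : (ℕ → Bool) → ℕ → Prop := fun ω n => levelLen c n ^ (d' : ℝ) ≤ prefixMass φ ω n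
  have hK : ∀ {ω ω' : ℕ → Bool} {n : ℕ}, (∀ k < n, ω k = ω' k) → K ω n → K ω' n := by
    intro ω ω' n h h1
    simp only [K] at h1 ⊢
    rwa [← prefixMass_congr h]
  let good : ℕ → List Bool → Prop := fun M v =>
    M ≤ v.length ∧ K (e v) v.length ∧ ∀ m < v.length, M ≤ m → ¬ K (e v) m
  have key := Measure.hausdorffMeasure_le_liminf_tsum (ι := fun M => {v // good M v})
    (d' : ℝ) E (l := atTop) (fun M => ENNReal.ofReal (levelLen c M))
    (by simpa using ENNReal.tendsto_ofReal (tendsto_levelLen hB hc))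
    (fun M v => cell c (e v) v.1.length)
    (Eventually.of_forall fun M v => by
      rw [ediam_cell]
      exact ENNReal.ofReal_le_ofReal (levelLen_antitone hB hc v.2.1))
    (Eventually.of_forall fun M x hx => by
      obtain ⟨ω, hω, hf⟩ := hE x hx
      have hex : ∃ n, M ≤ n ∧ K ω n := by
        obtain ⟨n, hn, hMn⟩ := ((hf ε hε).and_eventually (eventually_ge_atTop M)).exists
        refine ⟨n, hMn, ?_⟩
        simp only [K]
        rw [prefixMass_eq_exp hρ hφ, levelLen_eq_exp hB hc, ← Real.exp_mul]
        refine Real.exp_le_exp.2 ?_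
        have h0 : 0 ≤ logScale c n := by
          rcases eq_or_ne n 0 with rfl | h
          · simp [logScale]
          · exact (logScale_pos hB hc h).le
        nlinarith [mul_le_mul_of_nonneg_right hdd' h0]
      classical
      set n := Nat.find hex with hn
      have hn1 := Nat.find_spec hex
      have hag : ∀ k < n, ω k = e (pref ω n) k := by
        have := he (pref ω n)
        rw [length_pref] at this
        exact pref_eq_iff.1 this.symm
      refine mem_iUnion.2 ⟨⟨pref ω n, ?_, ?_, ?_⟩, ?_⟩
      · rw [length_pref]; exact hn1.1
      · rw [length_pref]; exact hK hag hn1.2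
      · rw [length_pref]
        intro m hm hMm hKm
        exact Nat.find_min hex hm ⟨hMm, hK (fun k hk => (hag k (hk.trans hm)).symm) hKm⟩
      · simp only [length_pref]
        rw [← cell_congr hag]
        exact hω n)
  refine dimH_le_of_hausdorffMeasure_ne_top (ne_top_of_le_ne_top ENNReal.one_ne_top
    (key.trans ?_))
  refine (liminf_le_liminf (v := fun _ => (1 : ENNReal)) (Eventually.of_forall fun M => ?_)).trans
    (by simp)
  have h1 : ∀ v : {v // good M v}, ediam (cell c (e v) v.1.length) ^ (d' : ℝ) ≤
      P {ω' | ∀ k < v.1.length, ω' k = e v k} := by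
    intro v
    rw [ediam_cell, hcyl, ENNReal.ofReal_rpow_of_nonneg (levelLen_pos hB hc _).le d'.coe_nonneg]
    exact ENNReal.ofReal_le_ofReal v.2.2.1
  refine (ENNReal.tsum_le_tsum h1).trans ?_
  refine (tsum_meas_le_meas_iUnion_of_disjoint P (fun v => measurableSet_cylinder _ _) ?_).trans
    prob_le_one
  have aux : ∀ v w : {v // good M v}, v.1.length ≤ w.1.length → ∀ ω' : ℕ → Bool,
      (∀ k < v.1.length, ω' k = e v k) → (∀ k < w.1.length, ω' k = e w k) → v = w := by
    intro v w hvw ω' hv hw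
    rcases hvw.lt_or_eq with h | h
    · refine absurd (hK (fun k hk => ?_) v.2.2.1) (w.2.2.2 _ h v.2.1)
      rw [← hv k hk, hw k (hk.trans h)]
    · apply Subtype.ext
      rw [← he v.1, ← he w.1, h]
      refine pref_eq_iff.2 fun k hk => ?_
      rw [← hv k (h ▸ hk), hw k hk]
  intro v w hvw
  refine Set.disjoint_left.2 fun ω' hv hw => hvw ?_
  rcases le_total v.1.length w.1.length with h | h
  · exact aux v w h ω' hv hw
  · exact (aux w v h ω' hw hv).symm

/-- Mass distribution principle, lower bound. -/
lemma le_dimH_of_eventually (hB : 2 < B) (hc : ∀ k, B ≤ c (k + 1)) (hcA : ∀ k, c (k + 1) ≤ A)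
    {θ : ℕ → ℝ} {P : Measure (ℕ → Bool)} [IsProbabilityMeasure P]
    (hP : ∀ ω n, P {ω' | ∀ k < n, ω' k = ω k} = ENNReal.ofReal (prefixMass θ ω n))
    {E : Set ℝ} (hE : ∀ᵐ ω ∂P, codedPoint c ω ∈ E ∧
      ∀ ε > 0, ∀ᶠ n in atTop, prefixMass θ ω n ≤ Real.exp (-((d - ε) * logScale c n))) :
    ENNReal.ofReal d ≤ dimH E := by
  refine ENNReal.le_of_forall_nnreal_lt fun d' hd' => ?_
  rcases eq_or_ne d' 0 with rfl | hd0
  · simp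
  have hd0' : 0 < (d' : ℝ) := NNReal.coe_pos.2 (pos_iff_ne_zero.2 hd0)
  have hd'd : (d' : ℝ) < d := by
    have := (ENNReal.coe_lt_coe.1 hd' : d' < d.toNNReal)
    exact (Real.lt_toNNReal_iff_coe_lt).1 this
  let F : ℕ → Set (ℕ → Bool) := fun M =>
    {ω | ∀ n ≥ M, prefixMass θ ω n ≤ levelLen c n ^ (d' : ℝ)}
  have hmeasPM : ∀ n, Measurable fun ω : ℕ → Bool => prefixMass θ ω n := by
    intro n
    refine Finset.measurable_prod _ fun k _ => ?_
    exact (measurable_of_countable (fun b : Bool => if b then 1 - θ k else θ k)).comp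
      (measurable_pi_apply k)
  have hFm : ∀ M, MeasurableSet (F M) := by
    intro M
    have : F M = ⋂ n, ⋂ (_ : n ≥ M), {ω | prefixMass θ ω n ≤ levelLen c n ^ (d' : ℝ)} := by
      ext; simp [F]
    rw [this]
    exact MeasurableSet.iInter fun n => MeasurableSet.iInter fun _ =>
      measurableSet_le (hmeasPM n) measurable_const
  have hunion : ∀ᵐ ω ∂P, ω ∈ ⋃ M, F M := by
    filter_upwards [hE] with ω hω
    obtain ⟨M, hM⟩ := eventually_atTop.1 (hω.2 (d - d') (by linarith))
    refine mem_iUnion.2 ⟨M, fun n hn => (hM n hn).trans (le_of_eq ?_)⟩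
    rw [levelLen_eq_exp hB hc, ← Real.exp_mul]
    congr 1
    ring
  obtain ⟨M, hM⟩ : ∃ M, P (F M) ≠ 0 := by
    by_contra! h
    have h1 : P (⋃ M, F M) = 0 := measure_iUnion_null h
    have h2 : P (⋃ M, F M) = 1 := by
      rw [prob_compl_eq_zero_iff (MeasurableSet.iUnion hFm) |>.symm]
      exact hunion
    rw [h1] at h2
    exact zero_ne_one h2
  set Q : Measure ℝ := (P.restrict (F M)).map (codedPoint c) with hQ
  have hcp := measurable_codedPoint (c := c) hB hc
  have hQE : Q E ≠ 0 := by
    intro h0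
    have h1 : (P.restrict (F M)) (codedPoint c ⁻¹' E) = 0 :=
      le_antisymm ((Measure.le_map_apply hcp.aemeasurable E).trans h0.le) bot_le
    have h2 : ∀ᵐ ω ∂P.restrict (F M), codedPoint c ω ∉ E := by
      rw [ae_iff]; simp only [not_not]; exact h1
    have h3 : ∀ᵐ ω ∂P.restrict (F M), codedPoint c ω ∈ E :=
      (ae_restrict_of_ae hE).mono fun ω h => h.1
    have h4 : ∀ᵐ ω ∂P.restrict (F M), False := by
      filter_upwards [h2, h3] with ω h5 h6 using h5 h6
    simp at h4
    exact hM h4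
  set κ : ℝ := (1 - 2 / B) / A with hκ
  have hA0 : 0 < A := by linarith [hc 0, hcA 0]
  have hκ0 : 0 < κ := by
    refine div_pos ?_ hA0
    have : 2 / B < 1 := by rw [div_lt_one (by linarith)]; exact hB
    linarith
  have hkey : ∀ s : Set ℝ, ediam s ≤ ENNReal.ofReal (κ * levelLen c M / 2) →
      Q s ≤ ENNReal.ofReal (κ⁻¹ ^ (d' : ℝ)) * ediam s ^ (d' : ℝ) := by
    intro s hs
    set δ := (ediam s).toReal with hδ
    have hdiam_ne : ediam s ≠ ⊤ := ne_top_of_le_ne_top ENNReal.ofReal_ne_top hs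
    have hδs : ENNReal.ofReal δ = ediam s := ENNReal.ofReal_toReal hdiam_ne
    have hQs : ∀ n ≥ M, δ < (1 - 2 / B) * levelLen c n →
        Q s ≤ ENNReal.ofReal (levelLen c n ^ (d' : ℝ)) := by
      intro n hn hδn
      refine (measure_mono (subset_closure : s ⊆ closure s)).trans ?_
      rw [hQ, Measure.map_apply hcp isClosed_closure.measurableSet,
        Measure.restrict_apply (hcp isClosed_closure.measurableSet)]
      rcases (codedPoint c ⁻¹' closure s ∩ F M).eq_empty_or_nonempty with h | ⟨ω, hω1, hω2⟩
      · simp [h]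
      · refine le_trans (measure_mono (t := {ω' | ∀ k < n, ω' k = ω k}) ?_)
          ((hP ω n).trans_le (ENNReal.ofReal_le_ofReal (hω2 n hn)))
        rintro ω' ⟨hω', -⟩
        by_contra hne
        have h1 := le_dist_of_mem_cell hB hc hne (codedPoint_mem_cell hB hc ω' n)
          (codedPoint_mem_cell hB hc ω n)
        have h2 : edist (codedPoint c ω') (codedPoint c ω) ≤ ENNReal.ofReal δ := by
          rw [hδs, ← ediam_closure s]
          exact edist_le_ediam_of_mem hω' hω1
        rw [edist_le_ofReal ENNReal.toReal_nonneg, Real.dist_eq] at h2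
        linarith
    have hκ' : κ * A = 1 - 2 / B := by rw [hκ]; field_simp
    have hA1 : 2 < A := by linarith [hc 0, hcA 0]
    have hstep : ∀ n, κ * levelLen c n ≤ (1 - 2 / B) * levelLen c (n + 1) := by
      intro n
      have hcpos : 0 < c (n + 1) := by linarith [hc n]
      have h1 : 1 ≤ A * (c (n + 1))⁻¹ := by
        rw [← div_eq_mul_inv, one_le_div hcpos]; exact hcA n
      rw [levelLen_succ, ← hκ']
      have := levelLen_pos hB hc n
      calc κ * levelLen c n = κ * levelLen c n * 1 := by ring
        _ ≤ κ * levelLen c n * (A * (c (n + 1))⁻¹) := by gcongr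
        _ = _ := by ring
    have hδM : δ < (1 - 2 / B) * levelLen c M := by
      have h1 : δ ≤ κ * levelLen c M / 2 := by
        refine ENNReal.toReal_le_of_le_ofReal ?_ hs
        have := levelLen_pos hB hc M
        positivity
      have h2 : 0 < κ * levelLen c M := mul_pos hκ0 (levelLen_pos hB hc M)
      rw [← hκ']
      nlinarith
    have hlim : Tendsto (fun n => (1 - 2 / B) * levelLen c n) atTop (𝓝 0) := by
      simpa using (tendsto_levelLen hB hc).const_mul (1 - 2 / B)
    rcases (ENNReal.toReal_nonneg : 0 ≤ δ).eq_or_lt with h0 | h0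
    · have h1 : Tendsto (fun n => ENNReal.ofReal (levelLen c n ^ (d' : ℝ))) atTop (𝓝 0) := by
        have := ENNReal.tendsto_ofReal ((tendsto_levelLen (c := c) hB hc).rpow_const
          (p := (d' : ℝ)) (Or.inr hd0'.le))
        simpa [Real.zero_rpow hd0'.ne'] using this
      have h2 : Q s ≤ 0 := ge_of_tendsto h1 (by
        filter_upwards [eventually_ge_atTop M] with n hn
        refine hQs n hn ?_
        rw [show δ = 0 from h0.symm, ← hκ']
        exact mul_pos (mul_pos hκ0 hA0) (levelLen_pos hB hc n))
      exact h2.trans bot_le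
    · classical
      have hex : ∃ n, M ≤ n ∧ (1 - 2 / B) * levelLen c (n + 1) ≤ δ := by
        obtain ⟨n, h1, h2⟩ := (((hlim.comp (tendsto_add_atTop_nat 1)).eventually
          (gt_mem_nhds h0)).and (eventually_ge_atTop M)).exists
        exact ⟨n, h2, le_of_lt h1⟩
      set n := Nat.find hex with hn
      obtain ⟨hn1, hn2⟩ := Nat.find_spec hex
      have hn3 : δ < (1 - 2 / B) * levelLen c n := by
        rcases hn1.eq_or_lt with h | h
        · rw [hn, ← h]; exact hδM
        · have hpos : 0 < n := by omega
          have := Nat.find_min hex (m := n - 1) (by omega)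
          push Not at this
          have h3 := this (by omega)
          rwa [Nat.sub_add_cancel hpos] at h3
      refine (hQs n hn1 hn3).trans ?_
      rw [← hδs, ENNReal.ofReal_rpow_of_nonneg h0.le hd0'.le,
        ← ENNReal.ofReal_mul (by positivity), ← Real.mul_rpow (by positivity) h0.le]
      refine ENNReal.ofReal_le_ofReal (Real.rpow_le_rpow (levelLen_pos hB hc n).le ?_ hd0'.le)
      rw [inv_mul_eq_div, le_div_iff₀ hκ0, mul_comm]
      exact (hstep n).trans hn2
  have hle : (ENNReal.ofReal (κ⁻¹ ^ (d' : ℝ)))⁻¹ • Q ≤ μH[(d' : ℝ)] := by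
    refine Measure.le_hausdorffMeasure _ _ (ENNReal.ofReal (κ * levelLen c M / 2)) ?_ ?_
    · have := levelLen_pos hB hc M
      rw [ENNReal.ofReal_pos]; positivity
    · intro s hs
      rw [Measure.smul_apply, smul_eq_mul]
      have h0 : ENNReal.ofReal (κ⁻¹ ^ (d' : ℝ)) ≠ 0 := by
        rw [Ne, ENNReal.ofReal_eq_zero, not_le]; positivity
      rw [ENNReal.inv_mul_le_iff h0 ENNReal.ofReal_ne_top]
      exact hkey s hs
  refine le_dimH_of_hausdorffMeasure_ne_zero fun h0 => hQE ?_
  have h1 := (hle E).trans h0.le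
  rw [Measure.smul_apply, smul_eq_mul, nonpos_iff_eq_zero, mul_eq_zero] at h1
  refine h1.resolve_left ?_
  simp
end

/-- The pressure `log (ρ^s + (1-ρ)^s)` of the weights `(ρ, 1-ρ)`. -/
noncomputable def pressure (ρ s : ℝ) : ℝ := Real.log (ρ ^ s + (1 - ρ) ^ s)

/-- The weight of `false` in the Gibbs vector proportional to `(ρ^s, (1-ρ)^s)`. -/
noncomputable def gibbs (ρ s : ℝ) : ℝ := ρ ^ s / (ρ ^ s + (1 - ρ) ^ s)

/-- The mean information of the weights `(ρ, 1-ρ)` under the law `(t, 1-t)`. -/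
noncomputable def meanInfo (ρ t : ℝ) : ℝ := t * -Real.log ρ + (1 - t) * -Real.log (1 - ρ)

section
variable {ρ : ℝ}

lemma one_sub_gibbs (h0 : 0 < ρ) (h1 : ρ < 1) (s : ℝ) :
    1 - gibbs ρ s = (1 - ρ) ^ s / (ρ ^ s + (1 - ρ) ^ s) := by
  have := Real.rpow_pos_of_pos h0 s
  have := Real.rpow_pos_of_pos (sub_pos.2 h1) s
  rw [gibbs]
  field_simp
  ring

lemma gibbs_mem (h0 : 0 < ρ) (h1 : ρ < 1) (s : ℝ) : 0 < gibbs ρ s ∧ 0 < 1 - gibbs ρ s := by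
  have := Real.rpow_pos_of_pos h0 s
  have := Real.rpow_pos_of_pos (sub_pos.2 h1) s
  rw [one_sub_gibbs h0 h1, gibbs]
  constructor <;> positivity

lemma neg_log_gibbs (h0 : 0 < ρ) (h1 : ρ < 1) (s : ℝ) :
    -Real.log (gibbs ρ s) = s * -Real.log ρ + pressure ρ s := by
  have h2 := Real.rpow_pos_of_pos h0 s
  have h3 := Real.rpow_pos_of_pos (sub_pos.2 h1) s
  rw [gibbs, Real.log_div h2.ne' (by positivity), Real.log_rpow h0, pressure]
  ring

lemma neg_log_one_sub_gibbs (h0 : 0 < ρ) (h1 : ρ < 1) (s : ℝ) :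
    -Real.log (1 - gibbs ρ s) = s * -Real.log (1 - ρ) + pressure ρ s := by
  have h2 := Real.rpow_pos_of_pos h0 s
  have h3 := Real.rpow_pos_of_pos (sub_pos.2 h1) s
  rw [one_sub_gibbs h0 h1, Real.log_div h3.ne' (by positivity), Real.log_rpow (sub_pos.2 h1),
    pressure]
  ring

lemma meanInfo_self (t : ℝ) : meanInfo t t = Real.binEntropy t := by
  rw [meanInfo, Real.binEntropy, Real.log_inv, Real.log_inv]

lemma binEntropy_gibbs (h0 : 0 < ρ) (h1 : ρ < 1) (s : ℝ) :
    Real.binEntropy (gibbs ρ s) = s * meanInfo ρ (gibbs ρ s) + pressure ρ s := by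
  rw [← meanInfo_self]
  conv_lhs => rw [meanInfo, neg_log_gibbs h0 h1, neg_log_one_sub_gibbs h0 h1]
  rw [meanInfo]
  ring

lemma gibbs_one (ρ : ℝ) : gibbs ρ 1 = ρ := by simp [gibbs]

lemma gibbs_zero (ρ : ℝ) : gibbs ρ 0 = 1 / 2 := by norm_num [gibbs]

lemma pressure_one (ρ : ℝ) : pressure ρ 1 = 0 := by simp [pressure]

lemma pressure_zero (ρ : ℝ) : pressure ρ 0 = Real.log 2 := by norm_num [pressure]

lemma deriv_betaFn (h0 : 0 < ρ) (h1 : ρ < 1) (C s : ℝ) :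
    deriv (betaFn ρ C) s = meanInfo ρ (gibbs ρ s) / Real.log C := by
  have h2 := Real.rpow_pos_of_pos h0 s
  have h3 := Real.rpow_pos_of_pos (sub_pos.2 h1) s
  have hd1 := (Real.hasStrictDerivAt_const_rpow h0 s).hasDerivAt
  have hd2 := (Real.hasStrictDerivAt_const_rpow (sub_pos.2 h1) s).hasDerivAt
  have h := (((hd1.add hd2).log (by simp only [Pi.add_apply]; positivity)).neg).div_const
    (Real.log C)
  have h' : HasDerivAt (betaFn ρ C) _ s := h
  rw [h'.deriv, meanInfo, one_sub_gibbs h0 h1, gibbs]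
  simp only [Pi.add_apply]
  congr 1
  field_simp
  ring

/-- For `t ∈ (0,1)`, the law `(t, 1-t)` is a Gibbs vector of `(ρ, 1-ρ)`. -/
lemma exists_gibbs_eq (h0 : 0 < ρ) (h1 : ρ < 1 / 2) {t : ℝ} (ht0 : 0 < t) (ht1 : t < 1) :
    ∃ s, gibbs ρ s = t ∧ (t ≤ ρ → 1 ≤ s) ∧ (1 / 2 ≤ t → s ≤ 0) := by
  set L := Real.log (1 - ρ) - Real.log ρ with hL
  have hLpos : 0 < L := sub_pos.2 (Real.log_lt_log h0 (by linarith))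
  set s := (Real.log (1 - t) - Real.log t) / L with hs
  have hsL : s * L = Real.log (1 - t) - Real.log t := by rw [hs]; field_simp
  refine ⟨s, ?_, fun h => ?_, fun h => ?_⟩
  · have h2 := Real.rpow_pos_of_pos h0 s
    have h3 : (1 - ρ) ^ s * t = ρ ^ s * (1 - t) := by
      rw [Real.rpow_def_of_pos h0, Real.rpow_def_of_pos (by linarith : 0 < 1 - ρ)]
      have h5 : Real.exp (Real.log (1 - ρ) * s) * Real.exp (Real.log t) =
          Real.exp (Real.log ρ * s) * Real.exp (Real.log (1 - t)) := by
        rw [← Real.exp_add, ← Real.exp_add]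
        congr 1
        rw [hL] at hsL
        linarith
      rwa [Real.exp_log ht0, Real.exp_log (sub_pos.2 ht1)] at h5
    have h4 := Real.rpow_pos_of_pos (by linarith : 0 < 1 - ρ) s
    rw [gibbs, div_eq_iff (by positivity)]
    linarith
  · rw [hs, le_div_iff₀ hLpos, one_mul, hL]
    have := Real.log_le_log ht0 h
    have := Real.log_le_log (by linarith : 0 < 1 - ρ) (by linarith : 1 - ρ ≤ 1 - t)
    linarith
  · rw [hs]
    refine div_nonpos_of_nonpos_of_nonneg ?_ hLpos.le
    have := Real.log_le_log (by linarith : 0 < 1 - t) (by linarith : 1 - t ≤ t)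
    linarith

lemma log_mean_lt (h0 : 0 < ρ) (h1 : ρ < 1 / 2) : -Real.log (1 - ρ) < -Real.log ρ := by
  have := Real.log_lt_log h0 (by linarith : ρ < 1 - ρ)
  linarith

/-- At the end points of the range of means the Legendre transform tends to `0`. -/
lemma exists_legendre_small_right (h0 : 0 < ρ) (h1 : ρ < 1 / 2) {ε : ℝ} (hε : 0 < ε) :
    ∃ s, 1 ≤ s ∧ s * -Real.log (1 - ρ) + pressure ρ s ≤ ε := by
  have h2 : 0 < 1 - ρ := by linarith
  have hx0 : 0 < ρ / (1 - ρ) := by positivity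
  have hx1 : ρ / (1 - ρ) < 1 := by rw [div_lt_one h2]; linarith
  have := (tendsto_rpow_atTop_of_base_lt_one _ (by linarith) hx1).eventually (gt_mem_nhds hε)
  obtain ⟨s, hs, hs1⟩ := (this.and (eventually_ge_atTop 1)).exists
  refine ⟨s, hs1, ?_⟩
  have h3 := Real.rpow_pos_of_pos h2 s
  have h4 := Real.rpow_pos_of_pos h0 s
  have h5 : pressure ρ s = s * Real.log (1 - ρ) + Real.log ((ρ / (1 - ρ)) ^ s + 1) := by
    rw [← Real.log_rpow h2, ← Real.log_mul h3.ne' (by positivity), pressure,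
      Real.div_rpow h0.le h2.le]
    congr 1
    field_simp
  have h6 := Real.log_le_sub_one_of_pos (by positivity : 0 < (ρ / (1 - ρ)) ^ s + 1)
  rw [h5]
  linarith

lemma pressure_one_sub_neg (h0 : 0 < ρ) (h1 : ρ < 1) (s : ℝ) :
    pressure ρ (-s) = s * -Real.log ρ + s * -Real.log (1 - ρ) + pressure ρ s := by
  have h2 : 0 < 1 - ρ := by linarith
  have h3 := Real.rpow_pos_of_pos h2 s
  have h4 := Real.rpow_pos_of_pos h0 s
  rw [pressure, pressure, Real.rpow_neg h0.le, Real.rpow_neg h2.le,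
    show (ρ ^ s)⁻¹ + ((1 - ρ) ^ s)⁻¹ = (ρ ^ s + (1 - ρ) ^ s) / (ρ ^ s * (1 - ρ) ^ s) by
      field_simp; ring, Real.log_div (by positivity) (by positivity),
    Real.log_mul h4.ne' h3.ne', Real.log_rpow h0, Real.log_rpow h2]
  ring

lemma exists_legendre_small_left (h0 : 0 < ρ) (h1 : ρ < 1 / 2) {ε : ℝ} (hε : 0 < ε) :
    ∃ s ≤ 0, s * -Real.log ρ + pressure ρ s ≤ ε := by
  obtain ⟨s, hs, h⟩ := exists_legendre_small_right h0 h1 hε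
  refine ⟨-s, by linarith, ?_⟩
  rw [pressure_one_sub_neg h0 (by linarith)]
  linarith

/-- A mean in the closed range of attainable means is either realised by a Gibbs vector, or has
vanishing Legendre transform. -/
lemma gibbs_or_legendre_small (h0 : 0 < ρ) (h1 : ρ ≤ 1 / 2) {m : ℝ}
    (hm1 : -Real.log (1 - ρ) ≤ m) (hm2 : m ≤ -Real.log ρ) (S : Set ℝ)
    (hS : S = Ici 1 ∧ m ≤ meanInfo ρ ρ ∨ S = Iic 0 ∧ meanInfo ρ (1 / 2) ≤ m ∨ S = univ) :
    (∃ s ∈ S, ∃ t, 0 < t ∧ t < 1 ∧ meanInfo ρ t = m ∧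
      Real.binEntropy t = s * m + pressure ρ s) ∨
    ∀ ε > 0, ∃ s ∈ S, s * m + pressure ρ s ≤ ε := by
  rcases h1.eq_or_lt with rfl | h1
  · have h2 : (1 : ℝ) - 1 / 2 = 1 / 2 := by norm_num
    rw [h2] at hm1
    have hm : m = -Real.log (1 / 2) := le_antisymm hm2 hm1
    have hl : -Real.log (1 / 2 : ℝ) = Real.log 2 := by simp
    classical
    refine Or.inl ⟨if (1 : ℝ) ∈ S then 1 else 0, ?_, 1 / 2, by norm_num, by norm_num, ?_, ?_⟩
    · rcases hS with h | h | h <;> split_ifs with h' <;> simp_all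
    · rw [meanInfo, h2, hm]; ring
    · rw [one_div, Real.binEntropy_two_inv, hm, hl]
      split_ifs
      · rw [pressure_one]; ring
      · rw [pressure_zero]; ring
  have hlt := log_mean_lt h0 h1
  rcases hm1.eq_or_lt with rfl | hm1
  · right
    intro ε hε
    have h3 : -Real.log (1 - ρ) < meanInfo ρ (1 / 2) := by rw [meanInfo]; linarith
    obtain ⟨s, hs, h⟩ := exists_legendre_small_right h0 h1 hε
    refine ⟨s, ?_, h⟩
    rcases hS with h | h | h
    · rw [h.1]; exact hs
    · exact absurd h.2 (not_le.2 h3)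
    · rw [h]; trivial
  rcases hm2.eq_or_lt with rfl | hm2
  · right
    intro ε hε
    have h3 : meanInfo ρ ρ < -Real.log ρ := by
      rw [meanInfo]; nlinarith
    obtain ⟨s, hs, h⟩ := exists_legendre_small_left h0 h1 hε
    refine ⟨s, ?_, h⟩
    rcases hS with h | h | h
    · exact absurd h.2 (not_le.2 h3)
    · rw [h.1]; exact hs
    · rw [h]; trivial
  left
  set D := -Real.log ρ - -Real.log (1 - ρ) with hD
  have hD0 : 0 < D := sub_pos.2 hlt
  set t := (m - -Real.log (1 - ρ)) / D with ht
  have htD : t * D = m - -Real.log (1 - ρ) := by rw [ht]; field_simp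
  have hmean : meanInfo ρ t = m := by rw [meanInfo]; rw [hD] at htD; linarith
  have ht0 : 0 < t := div_pos (by linarith) hD0
  have ht1 : t < 1 := by rw [ht, div_lt_one hD0]; linarith
  have hmono : ∀ u v, meanInfo ρ u ≤ meanInfo ρ v → u ≤ v := by
    intro u v huv
    have : 0 ≤ (v - u) * D := by rw [hD]; simp only [meanInfo] at huv; linarith
    nlinarith
  obtain ⟨s, hs, hs1, hs2⟩ := exists_gibbs_eq h0 h1 ht0 ht1
  refine ⟨s, ?_, t, ht0, ht1, hmean, ?_⟩
  · rcases hS with h | h | h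
    · rw [h.1]; exact hs1 (hmono _ _ (hmean.trans_le h.2))
    · rw [h.1]; exact hs2 (hmono _ _ (h.2.trans hmean.ge))
    · rw [h]; trivial
  · rw [← hs, binEntropy_gibbs h0 (by linarith), hs, hmean]

lemma pressure_bounds_right (h0 : 0 < ρ) (h1 : ρ ≤ 1 / 2) {s : ℝ} (hs : 1 ≤ s) :
    (s - 1) * Real.log ρ ≤ pressure ρ s ∧ pressure ρ s ≤ (s - 1) * Real.log (1 - ρ) := by
  have h2 : 0 < 1 - ρ := by linarith
  have h3 : ∀ x : ℝ, 0 < x → x ^ s = x ^ (s - 1) * x := fun x hx => by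
    rw [Real.rpow_sub_one hx.ne']; field_simp
  have h4 := Real.rpow_le_rpow h0.le (by linarith : ρ ≤ 1 - ρ) (by linarith : 0 ≤ s - 1)
  have h5 := Real.rpow_pos_of_pos h0 (s - 1)
  have h6 := Real.rpow_pos_of_pos h2 (s - 1)
  rw [← Real.log_rpow h0, ← Real.log_rpow h2, pressure, h3 _ h0, h3 _ h2]
  constructor <;> refine Real.log_le_log (by positivity) (by nlinarith)

lemma pressure_bounds_left (h0 : 0 < ρ) (h1 : ρ ≤ 1 / 2) {s : ℝ} (hs : s ≤ 1) :
    (s - 1) * Real.log (1 - ρ) ≤ pressure ρ s ∧ pressure ρ s ≤ (s - 1) * Real.log ρ := by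
  have h2 : 0 < 1 - ρ := by linarith
  have h3 : ∀ x : ℝ, 0 < x → x ^ s = x ^ (s - 1) * x := fun x hx => by
    rw [Real.rpow_sub_one hx.ne']; field_simp
  have h4 := Real.rpow_le_rpow_of_nonpos h0 (by linarith : ρ ≤ 1 - ρ) (by linarith : s - 1 ≤ 0)
  have h5 := Real.rpow_pos_of_pos h0 (s - 1)
  have h6 := Real.rpow_pos_of_pos h2 (s - 1)
  rw [← Real.log_rpow h0, ← Real.log_rpow h2, pressure, h3 _ h0, h3 _ h2]
  constructor <;> refine Real.log_le_log (by positivity) (by nlinarith)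
end

/-- The standing assumptions on a Moran construction which alternates between the parameters
`(A, p)` and `(B, q)` on rapidly growing blocks of levels. -/
structure TwoScale (A B p q : ℝ) (N : ℕ → ℕ) (c r : ℕ → ℝ) : Prop where
  lt_AB : B < A
  two_lt : 2 < B
  p_pos : 0 < p
  p_le : p ≤ 1 / 2
  q_pos : 0 < q
  q_le : q ≤ 1 / 2
  N_zero : N 0 = 0
  N_mono : StrictMono N
  N_lim : Tendsto (fun i : ℕ => (N (i + 1) : ℝ) / (N i : ℝ)) atTop atTop
  sep : -Real.log p / Real.log A < -Real.log (1 - q) / Real.log B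
  c_A : ∀ i n : ℕ, N (2 * i) < n → n ≤ N (2 * i + 1) → c n = A
  c_B : ∀ i n : ℕ, N (2 * i + 1) < n → n ≤ N (2 * i + 2) → c n = B
  r_p : ∀ i n : ℕ, N (2 * i) < n → n ≤ N (2 * i + 1) → r n = p
  r_q : ∀ i n : ℕ, N (2 * i + 1) < n → n ≤ N (2 * i + 2) → r n = q

lemma exists_block {N : ℕ → ℕ} (h0 : N 0 = 0) (hN : StrictMono N) (k : ℕ) :
    ∃ j, N j ≤ k ∧ k < N (j + 1) := by
  classical
  have hex : ∃ j, k < N (j + 1) := ⟨k, lt_of_lt_of_le (Nat.lt_succ_self k) (hN.id_le (k + 1))⟩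
  refine ⟨Nat.find hex, ?_, Nat.find_spec hex⟩
  rcases Nat.eq_zero_or_pos (Nat.find hex) with h | h
  · rw [h, h0]; exact Nat.zero_le _
  · have := Nat.find_min hex (m := Nat.find hex - 1) (by omega)
    rwa [Nat.sub_add_cancel h, not_lt] at this

lemma abs_le_of_abs_increment_le {D : ℕ → ℝ} {K : ℝ} (h0 : D 0 = 0)
    (hD : ∀ n, |D (n + 1) - D n| ≤ K) (n : ℕ) : |D n| ≤ K * n := by
  induction n with
  | zero => simp [h0]
  | succ n ih =>
    have h1 := abs_add_le (D (n + 1) - D n) (D n)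
    rw [sub_add_cancel] at h1
    push_cast
    linarith [hD n]

lemma eq_of_increment_eq {D : ℕ → ℝ} {u v : ℕ} (huv : u ≤ v)
    (hD : ∀ k, u ≤ k → k < v → D (k + 1) = D k) : D v = D u := by
  induction v, huv using Nat.le_induction with
  | base => rfl
  | succ v huv ih =>
    rw [hD v huv (Nat.lt_succ_self v)]
    exact ih fun k h1 h2 => hD k h1 (h2.trans (Nat.lt_succ_self v))

namespace TwoScale
variable {A B p q : ℝ} {N : ℕ → ℕ} {c r : ℕ → ℝ}

lemma even_block (h : TwoScale A B p q N c r) {i k : ℕ} (h1 : N (2 * i) ≤ k)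
    (h2 : k < N (2 * i + 1)) : c (k + 1) = A ∧ r (k + 1) = p :=
  ⟨h.c_A i _ (Nat.lt_succ_of_le h1) h2, h.r_p i _ (Nat.lt_succ_of_le h1) h2⟩

lemma odd_block (h : TwoScale A B p q N c r) {i k : ℕ} (h1 : N (2 * i + 1) ≤ k)
    (h2 : k < N (2 * i + 2)) : c (k + 1) = B ∧ r (k + 1) = q :=
  ⟨h.c_B i _ (Nat.lt_succ_of_le h1) h2, h.r_q i _ (Nat.lt_succ_of_le h1) h2⟩

lemma cases (h : TwoScale A B p q N c r) (k : ℕ) :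
    (c (k + 1) = A ∧ r (k + 1) = p) ∨ (c (k + 1) = B ∧ r (k + 1) = q) := by
  obtain ⟨j, h1, h2⟩ := exists_block h.N_zero h.N_mono k
  rcases Nat.even_or_odd' j with ⟨i, rfl | rfl⟩
  · exact Or.inl (h.even_block h1 h2)
  · exact Or.inr (h.odd_block h1 h2)

lemma B_le (h : TwoScale A B p q N c r) (k : ℕ) : B ≤ c (k + 1) := by
  rcases h.cases k with h1 | h1 <;> rw [h1.1]
  exact h.lt_AB.le

lemma le_A (h : TwoScale A B p q N c r) (k : ℕ) : c (k + 1) ≤ A := by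
  rcases h.cases k with h1 | h1 <;> rw [h1.1]
  exact h.lt_AB.le

lemma min_pos (h : TwoScale A B p q N c r) : 0 < min p q := lt_min h.p_pos h.q_pos

lemma r_bounds (h : TwoScale A B p q N c r) (k : ℕ) :
    min p q ≤ r (k + 1) ∧ r (k + 1) ≤ 1 - min p q := by
  have h1 := min_le_left p q
  have h2 := min_le_right p q
  have := h.p_le
  have := h.q_le
  rcases h.cases k with h3 | h3 <;> rw [h3.2] <;> constructor <;> linarith

lemma log_B_pos (h : TwoScale A B p q N c r) : 0 < Real.log B :=
  Real.log_pos (by linarith [h.two_lt])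

lemma log_A_pos (h : TwoScale A B p q N c r) : 0 < Real.log A :=
  Real.log_pos (by linarith [h.two_lt, h.lt_AB])

lemma tendsto_N (h : TwoScale A B p q N c r) : Tendsto N atTop atTop := h.N_mono.tendsto_atTop

lemma le_logScale (h : TwoScale A B p q N c r) (n : ℕ) : n * Real.log B ≤ logScale c n :=
  (logScale_mono_bounds h.two_lt h.B_le h.le_A n).1

lemma logScale_nonneg (h : TwoScale A B p q N c r) (n : ℕ) : 0 ≤ logScale c n :=
  le_trans (mul_nonneg n.cast_nonneg h.log_B_pos.le) (h.le_logScale n)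

/-- The starting point of a block is negligible compared to the scale at its end point. -/
lemma eventually_mul_N_le (h : TwoScale A B p q N c r) (K : ℝ) {ε : ℝ} (hε : 0 < ε) :
    ∀ᶠ j in atTop, ∀ n, N (j + 1) ≤ n → K * N j ≤ ε * logScale c n := by
  filter_upwards [h.N_lim.eventually_ge_atTop (|K| / (ε * Real.log B)), eventually_ge_atTop 1]
    with j hj hj1 n hn
  have hNj : 0 < (N j : ℝ) := by
    have := h.N_mono (show 0 < j by omega)
    rw [h.N_zero] at this
    exact_mod_cast this
  have hB := h.log_B_pos
  rw [div_le_div_iff₀ (by positivity) hNj] at hj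
  have h1 : (N (j + 1) : ℝ) ≤ n := by exact_mod_cast hn
  calc K * N j ≤ |K| * N j := by gcongr; exact le_abs_self K
    _ ≤ N (j + 1) * (ε * Real.log B) := hj
    _ = ε * (N (j + 1) * Real.log B) := by ring
    _ ≤ ε * (n * Real.log B) := by gcongr
    _ ≤ ε * logScale c n := by gcongr; exact h.le_logScale n

/-- A sequence with bounded increments which is constant on the block `j` is negligible at its
right endpoint. -/
lemma eventually_abs_le_of_const (h : TwoScale A B p q N c r) {D : ℕ → ℝ} {K : ℝ}
    (h0 : D 0 = 0) (hD : ∀ n, |D (n + 1) - D n| ≤ K) {ε : ℝ} (hε : 0 < ε) :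
    ∀ᶠ j in atTop, (∀ k, N j ≤ k → k < N (j + 1) → D (k + 1) = D k) →
      |D (N (j + 1))| ≤ ε * logScale c (N (j + 1)) := by
  filter_upwards [h.eventually_mul_N_le K hε] with j hj hconst
  rw [eq_of_increment_eq (h.N_mono.monotone (Nat.le_succ j)) hconst]
  exact (abs_le_of_abs_increment_le h0 hD _).trans (hj _ le_rfl)

lemma frequently_of_eventually_N (h : TwoScale A B p q N c r) {P : ℕ → Prop} {f : ℕ → ℕ}
    (hf : Tendsto f atTop atTop) (hP : ∀ᶠ i in atTop, P (N (f i))) : ∃ᶠ n in atTop, P n :=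
  (h.tendsto_N.comp hf).frequently hP.frequently

end TwoScale

/-- The accumulated pressure of the weights `r` at the exponent `s`. -/
noncomputable def pressureSum (r : ℕ → ℝ) (s : ℝ) (n : ℕ) : ℝ :=
  ∑ k ∈ Finset.range n, pressure (r (k + 1)) s

namespace TwoScale
variable {A B p q : ℝ} {N : ℕ → ℕ} {c r : ℕ → ℝ}

lemma p_lt_one (h : TwoScale A B p q N c r) : p < 1 := by linarith [h.p_le]

lemma q_lt_one (h : TwoScale A B p q N c r) : q < 1 := by linarith [h.q_le]

lemma infoSum_gibbs (h : TwoScale A B p q N c r) (s : ℝ) (ω : ℕ → Bool) (n : ℕ) :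
    infoSum (fun k => gibbs (r (k + 1)) s) ω n =
      s * infoSum (fun k => r (k + 1)) ω n + pressureSum r s n := by
  rw [infoSum, infoSum, pressureSum, Finset.mul_sum, ← Finset.sum_add_distrib]
  refine Finset.sum_congr rfl fun k _ => ?_
  have h1 := h.r_bounds k
  have h2 := h.min_pos
  split_ifs
  · exact neg_log_one_sub_gibbs (by linarith) (by linarith) s
  · exact neg_log_gibbs (by linarith) (by linarith) s

lemma dimH_le_of_infoSum (h : TwoScale A B p q N c r) (s : ℝ) {d : ℝ} {E : Set ℝ}
    (hE : ∀ x ∈ E, ∃ ω : ℕ → Bool, (∀ n, x ∈ cell c ω n) ∧ ∀ ε > 0, ∃ᶠ n in atTop,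
      s * infoSum (fun k => r (k + 1)) ω n + pressureSum r s n ≤ (d + ε) * logScale c n) :
    dimH E ≤ ENNReal.ofReal d := by
  obtain ⟨hp1, hp2⟩ := gibbs_mem h.p_pos h.p_lt_one s
  obtain ⟨hq1, hq2⟩ := gibbs_mem h.q_pos h.q_lt_one s
  set ρ := min (min (gibbs p s) (1 - gibbs p s)) (min (gibbs q s) (1 - gibbs q s)) with hρ
  have e1 : ρ ≤ gibbs p s := (min_le_left _ _).trans (min_le_left _ _)
  have e2 : ρ ≤ 1 - gibbs p s := (min_le_left _ _).trans (min_le_right _ _)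
  have e3 : ρ ≤ gibbs q s := (min_le_right _ _).trans (min_le_left _ _)
  have e4 : ρ ≤ 1 - gibbs q s := (min_le_right _ _).trans (min_le_right _ _)
  refine dimH_le_of_frequently (φ := fun k => gibbs (r (k + 1)) s) (ρ := ρ) h.two_lt h.B_le
    (lt_min (lt_min hp1 hp2) (lt_min hq1 hq2)) (fun k => ?_) ?_
  · rcases h.cases k with h1 | h1 <;> simp only [h1.2] <;> constructor <;> linarith
  · simpa only [h.infoSum_gibbs] using hE

lemma pressure_le_right (h : TwoScale A B p q N c r) {s : ℝ} (hs : 1 ≤ s) :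
    pressure q s / Real.log B ≤ pressure p s / Real.log A := by
  have h1 := (pressure_bounds_right h.p_pos h.p_le hs).1
  have h2 := (pressure_bounds_right h.q_pos h.q_le hs).2
  have hA := h.log_A_pos
  have hB := h.log_B_pos
  have h3 := h.sep
  calc pressure q s / Real.log B ≤ (s - 1) * Real.log (1 - q) / Real.log B := by gcongr
    _ = -((s - 1) * (-Real.log (1 - q) / Real.log B)) := by ring
    _ ≤ -((s - 1) * (-Real.log p / Real.log A)) := by
      have : 0 ≤ s - 1 := by linarith
      gcongr
    _ = (s - 1) * Real.log p / Real.log A := by ring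
    _ ≤ _ := by gcongr

lemma pressure_le_left (h : TwoScale A B p q N c r) {s : ℝ} (hs : s ≤ 1) :
    pressure p s / Real.log A ≤ pressure q s / Real.log B := by
  have h1 := (pressure_bounds_left h.p_pos h.p_le hs).2
  have h2 := (pressure_bounds_left h.q_pos h.q_le hs).1
  have hA := h.log_A_pos
  have hB := h.log_B_pos
  have h3 := h.sep
  calc pressure p s / Real.log A ≤ (s - 1) * Real.log p / Real.log A := by gcongr
    _ = (1 - s) * (-Real.log p / Real.log A) := by ring
    _ ≤ (1 - s) * (-Real.log (1 - q) / Real.log B) := by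
      have : 0 ≤ 1 - s := by linarith
      gcongr
    _ = (s - 1) * Real.log (1 - q) / Real.log B := by ring
    _ ≤ _ := by gcongr

lemma pressureSum_le (h : TwoScale A B p q N c r) {s b : ℝ}
    (h1 : pressure p s / Real.log A ≤ b) (h2 : pressure q s / Real.log B ≤ b) (n : ℕ) :
    pressureSum r s n ≤ b * logScale c n := by
  rw [pressureSum, logScale, Finset.mul_sum]
  refine Finset.sum_le_sum fun k _ => ?_
  rw [div_le_iff₀ h.log_A_pos] at h1
  rw [div_le_iff₀ h.log_B_pos] at h2
  rcases h.cases k with h3 | h3 <;> rwa [h3.1, h3.2]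

lemma pressureSum_block_end (h : TwoScale A B p q N c r) (s b : ℝ) {ε : ℝ} (hε : 0 < ε) :
    ∀ᶠ j in atTop, (∀ k, N j ≤ k → k < N (j + 1) →
      pressure (r (k + 1)) s = b * Real.log (c (k + 1))) →
      pressureSum r s (N (j + 1)) ≤ (b + ε) * logScale c (N (j + 1)) := by
  set D : ℕ → ℝ := fun n => pressureSum r s n - b * logScale c n with hD
  have hstep : ∀ n, D (n + 1) - D n = pressure (r (n + 1)) s - b * Real.log (c (n + 1)) := by
    intro n
    simp only [hD, pressureSum, logScale, Finset.sum_range_succ]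
    ring
  have hev := h.eventually_abs_le_of_const (D := D)
    (K := max |pressure p s - b * Real.log A| |pressure q s - b * Real.log B|)
    (by simp [hD, pressureSum, logScale]) (fun n => by
      rw [hstep]
      rcases h.cases n with h3 | h3 <;> rw [h3.1, h3.2]
      · exact le_max_left _ _
      · exact le_max_right _ _) hε
  filter_upwards [hev] with j hj hconst
  have h1 := le_of_abs_le (hj fun k hk1 hk2 => by
    have := hstep k
    rw [hconst k hk1 hk2] at this
    linarith)
  simp only [hD] at h1
  linarith

lemma pressureSum_even_end (h : TwoScale A B p q N c r) (s : ℝ) {ε : ℝ} (hε : 0 < ε) :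
    ∀ᶠ i in atTop, pressureSum r s (N (2 * i + 1)) ≤
      (pressure p s / Real.log A + ε) * logScale c (N (2 * i + 1)) := by
  have h1 : Tendsto (fun i : ℕ => 2 * i) atTop atTop :=
    tendsto_atTop_mono (fun i => show i ≤ _ by omega) tendsto_id
  filter_upwards [h1.eventually (h.pressureSum_block_end s (pressure p s / Real.log A) hε)]
    with i hi
  refine hi fun k hk1 hk2 => ?_
  obtain ⟨h2, h3⟩ := h.even_block hk1 hk2
  rw [h2, h3, div_mul_cancel₀ _ h.log_A_pos.ne']

lemma pressureSum_odd_end (h : TwoScale A B p q N c r) (s : ℝ) {ε : ℝ} (hε : 0 < ε) :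
    ∀ᶠ i in atTop, pressureSum r s (N (2 * i + 1 + 1)) ≤
      (pressure q s / Real.log B + ε) * logScale c (N (2 * i + 1 + 1)) := by
  have h1 : Tendsto (fun i : ℕ => 2 * i + 1) atTop atTop :=
    tendsto_atTop_mono (fun i => show i ≤ _ by omega) tendsto_id
  filter_upwards [h1.eventually (h.pressureSum_block_end s (pressure q s / Real.log B) hε)]
    with i hi
  refine hi fun k hk1 hk2 => ?_
  obtain ⟨h2, h3⟩ := h.odd_block hk1 hk2
  rw [h2, h3, div_mul_cancel₀ _ h.log_B_pos.ne']

variable {μ : Measure ℝ} [IsProbabilityMeasure μ]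

lemma dimH_lower_le (h : TwoScale A B p q N c r)
    (hμ : ∀ w : List Bool, μ (moranI c w) = ENNReal.ofReal (cylMass r w 1 1)) (α : ℝ)
    {s : ℝ} (hs : s ≤ 0 ∨ 1 ≤ s) :
    dimH {x | x ∈ moranSet c ∧ lowerLocalDim μ x = α} ≤
      ENNReal.ofReal (s * α + pressure p s / Real.log A) := by
  refine h.dimH_le_of_infoSum s ?_
  rintro x ⟨hx, hα⟩
  obtain ⟨ω, hω⟩ := exists_coding h.two_lt h.B_le hx
  refine ⟨ω, hω, fun ε hε => ?_⟩
  rw [lowerLocalDim_eq_iff h.two_lt h.B_le h.le_A h.min_pos h.r_bounds hμ hω] at hα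
  obtain ⟨h1, h2⟩ := hα
  rcases hs with hs | hs
  · have hδ : 0 < ε / (1 - s) := div_pos hε (by linarith)
    have hf : Tendsto (fun i : ℕ => 2 * i + 1) atTop atTop :=
      tendsto_atTop_mono (fun i => show i ≤ _ by omega) tendsto_id
    refine h.frequently_of_eventually_N hf ?_
    filter_upwards [h.pressureSum_even_end s hδ, (h.tendsto_N.comp hf).eventually (h1 _ hδ)]
      with i h3 h4
    simp only [Function.comp_apply] at h4
    have h5 := mul_le_mul_of_nonpos_left h4 hs
    have h6 : ε / (1 - s) - s * (ε / (1 - s)) = ε := by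
      have : 1 - s ≠ 0 := by linarith
      field_simp
    calc _ ≤ s * ((α - ε / (1 - s)) * logScale c (N (2 * i + 1))) +
          (pressure p s / Real.log A + ε / (1 - s)) * logScale c (N (2 * i + 1)) := add_le_add h5 h3
      _ = (s * α + pressure p s / Real.log A + (ε / (1 - s) - s * (ε / (1 - s)))) *
          logScale c (N (2 * i + 1)) := by ring
      _ = _ := by rw [h6]
  · refine (h2 (ε / s) (div_pos hε (by linarith))).mono fun n hn => ?_
    have h3 := h.pressureSum_le (b := pressure p s / Real.log A) le_rfl (h.pressure_le_right hs) n
    have h5 := mul_le_mul_of_nonneg_left hn (by linarith : 0 ≤ s)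
    calc _ ≤ s * ((α + ε / s) * logScale c n) + _ := add_le_add h5 h3
      _ = _ := by
        have : s ≠ 0 := by linarith
        field_simp
        ring

lemma dimH_upper_le (h : TwoScale A B p q N c r)
    (hμ : ∀ w : List Bool, μ (moranI c w) = ENNReal.ofReal (cylMass r w 1 1)) (α s : ℝ) :
    dimH {x | x ∈ moranSet c ∧ upperLocalDim μ x = α} ≤
      ENNReal.ofReal (s * α + pressure q s / Real.log B) := by
  refine h.dimH_le_of_infoSum s ?_
  rintro x ⟨hx, hα⟩
  obtain ⟨ω, hω⟩ := exists_coding h.two_lt h.B_le hx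
  refine ⟨ω, hω, fun ε hε => ?_⟩
  rw [upperLocalDim_eq_iff h.two_lt h.B_le h.le_A h.min_pos h.r_bounds hμ hω] at hα
  obtain ⟨h1, h2⟩ := hα
  rcases le_or_gt 0 s with hs | hs
  · have hδ : 0 < ε / (1 + s) := div_pos hε (by linarith)
    have hf : Tendsto (fun i : ℕ => 2 * i + 1 + 1) atTop atTop :=
      tendsto_atTop_mono (fun i => show i ≤ _ by omega) tendsto_id
    refine h.frequently_of_eventually_N hf ?_
    filter_upwards [h.pressureSum_odd_end s hδ, (h.tendsto_N.comp hf).eventually (h1 _ hδ)]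
      with i h3 h4
    simp only [Function.comp_apply] at h4
    have h5 := mul_le_mul_of_nonneg_left h4 hs
    have h6 : ε / (1 + s) + s * (ε / (1 + s)) = ε := by
      have : 1 + s ≠ 0 := by linarith
      field_simp
    calc _ ≤ s * ((α + ε / (1 + s)) * logScale c (N (2 * i + 1 + 1))) +
          (pressure q s / Real.log B + ε / (1 + s)) * logScale c (N (2 * i + 1 + 1)) :=
          add_le_add h5 h3
      _ = (s * α + pressure q s / Real.log B + (ε / (1 + s) + s * (ε / (1 + s)))) *
          logScale c (N (2 * i + 1 + 1)) := by ring
      _ = _ := by rw [h6]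
  · refine (h2 (ε / -s) (div_pos hε (by linarith))).mono fun n hn => ?_
    have h3 := h.pressureSum_le (b := pressure q s / Real.log B)
      (h.pressure_le_left (by linarith)) le_rfl n
    have h5 := mul_le_mul_of_nonpos_left hn hs.le
    calc _ ≤ s * ((α - ε / -s) * logScale c n) + _ := add_le_add h5 h3
      _ = _ := by
        have : s ≠ 0 := by linarith
        field_simp
        ring

end TwoScale

/-- The expected information of `r` along the first `n` letters, the `k`-th letter having law
`(θ k, 1 - θ k)`. -/
noncomputable def meanSum (r θ : ℕ → ℝ) (n : ℕ) : ℝ :=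
  ∑ k ∈ Finset.range n, meanInfo (r (k + 1)) (θ k)

/-- The entropy of the first `n` letters, the `k`-th letter having law `(θ k, 1 - θ k)`. -/
noncomputable def entropySum (θ : ℕ → ℝ) (n : ℕ) : ℝ :=
  ∑ k ∈ Finset.range n, Real.binEntropy (θ k)

lemma meanInfo_mem_Icc {ρ r t : ℝ} (hρ : 0 < ρ) (hr : ρ ≤ r ∧ r ≤ 1 - ρ) (ht : 0 ≤ t ∧ t ≤ 1) :
    0 ≤ meanInfo r t ∧ meanInfo r t ≤ -Real.log ρ := by
  have h1 : 0 ≤ -Real.log r := by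
    have := Real.log_nonpos (by linarith : 0 ≤ r) (by linarith)
    linarith
  have h2 : 0 ≤ -Real.log (1 - r) := by
    have := Real.log_nonpos (by linarith : 0 ≤ 1 - r) (by linarith)
    linarith
  have h3 := Real.log_le_log hρ hr.1
  have h4 := Real.log_le_log hρ (by linarith : ρ ≤ 1 - r)
  have h5 : 0 ≤ 1 - t := by linarith
  refine ⟨add_nonneg (mul_nonneg ht.1 h1) (mul_nonneg h5 h2), ?_⟩
  calc meanInfo r t ≤ t * -Real.log ρ + (1 - t) * -Real.log ρ := by
        rw [meanInfo]
        have := ht.1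
        gcongr
    _ = _ := by ring

lemma sum_le_mul_logScale {c f : ℕ → ℝ} {a : ℝ}
    (hf : ∀ k, f k ≤ a * Real.log (c (k + 1))) (n : ℕ) :
    ∑ k ∈ Finset.range n, f k ≤ a * logScale c n := by
  rw [logScale, Finset.mul_sum]
  exact Finset.sum_le_sum fun k _ => hf k

lemma mul_logScale_le_sum {c f : ℕ → ℝ} {a : ℝ}
    (hf : ∀ k, a * Real.log (c (k + 1)) ≤ f k) (n : ℕ) :
    a * logScale c n ≤ ∑ k ∈ Finset.range n, f k := by
  rw [logScale, Finset.mul_sum]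
  exact Finset.sum_le_sum fun k _ => hf k

namespace TwoScale
variable {A B p q : ℝ} {N : ℕ → ℕ} {c r : ℕ → ℝ}
variable {μ : Measure ℝ} [IsProbabilityMeasure μ]

/-- If the sums of a sequence of bounded deviations grow sublinearly, they are negligible with
respect to the scale. -/
lemma eventually_abs_le_logScale (h : TwoScale A B p q N c r) {D : ℕ → ℝ}
    (hD : ∀ ε > 0, ∀ᶠ n : ℕ in atTop, |D n| ≤ ε * n) :
    ∀ ε > 0, ∀ᶠ n in atTop, |D n| ≤ ε * logScale c n := by
  intro ε hε
  filter_upwards [hD (ε * Real.log B) (mul_pos hε h.log_B_pos)] with n hn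
  calc |D n| ≤ ε * (n * Real.log B) := by linarith
    _ ≤ _ := by gcongr; exact h.le_logScale n

/-- Lower bound for the dimension through an inhomogeneous Bernoulli measure. -/
lemma le_dimH_of_bernoulli (h : TwoScale A B p q N c r)
    (hμ : ∀ w : List Bool, μ (moranI c w) = ENNReal.ofReal (cylMass r w 1 1))
    {θ : ℕ → ℝ} {ρ : ℝ} (hρ : 0 < ρ) (hθ : ∀ k, ρ ≤ θ k ∧ θ k ≤ 1 - ρ) {α α' d : ℝ}
    (h1 : ∀ ε > 0, ∀ᶠ n in atTop, (α - ε) * logScale c n ≤ meanSum r θ n)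
    (h2 : ∀ ε > 0, ∃ᶠ n in atTop, meanSum r θ n ≤ (α + ε) * logScale c n)
    (h3 : ∀ ε > 0, ∀ᶠ n in atTop, meanSum r θ n ≤ (α' + ε) * logScale c n)
    (h4 : ∀ ε > 0, ∃ᶠ n in atTop, (α' - ε) * logScale c n ≤ meanSum r θ n)
    (h5 : ∀ ε > 0, ∀ᶠ n in atTop, (d - ε) * logScale c n ≤ entropySum θ n) :
    ENNReal.ofReal d ≤
      dimH {x | x ∈ moranSet c ∧ lowerLocalDim μ x = α ∧ upperLocalDim μ x = α'} := by
  obtain ⟨P, hP, hcyl, hlln⟩ := exists_bernoulli_measure (θ := θ) fun k =>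
    ⟨hρ.le.trans (hθ k).1, (hθ k).2.trans (by linarith)⟩
  refine le_dimH_of_eventually (P := P) h.two_lt h.B_le h.le_A hcyl ?_
  have hb1 : ∀ (k : ℕ) (b : Bool), |-Real.log (if b then 1 - r (k + 1) else r (k + 1))| ≤
      -Real.log (min p q) := by
    intro k b
    have := letter_bounds h.min_pos h.r_bounds (fun _ => b) k
    rw [abs_of_nonneg this.2.1]
    exact this.2.2
  have hb2 : ∀ (k : ℕ) (b : Bool), |-Real.log (if b then 1 - θ k else θ k)| ≤ -Real.log ρ := by
    intro k b
    have := letter_bounds hρ hθ (fun _ => b) k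
    rw [abs_of_nonneg this.2.1]
    exact this.2.2
  filter_upwards [hlln _ _ hb1, hlln _ _ hb2] with ω hω1 hω2
  have e1 : ∀ ε > 0, ∀ᶠ n in atTop,
      |infoSum (fun k => r (k + 1)) ω n - meanSum r θ n| ≤ ε * logScale c n := by
    refine h.eventually_abs_le_logScale fun ε hε => (hω1 ε hε).mono fun n hn => ?_
    rw [infoSum, meanSum, ← Finset.sum_sub_distrib]
    simpa [meanInfo] using hn
  have e2 : ∀ ε > 0, ∀ᶠ n in atTop,
      |infoSum θ ω n - entropySum θ n| ≤ ε * logScale c n := by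
    refine h.eventually_abs_le_logScale fun ε hε => (hω2 ε hε).mono fun n hn => ?_
    rw [infoSum, entropySum, ← Finset.sum_sub_distrib]
    simpa [← meanInfo_self, meanInfo] using hn
  have hcell := codedPoint_mem_cell h.two_lt h.B_le ω
  refine ⟨⟨mem_moranSet_of_mem_cell hcell, ?_, ?_⟩, fun ε hε => ?_⟩
  · rw [lowerLocalDim_eq_iff h.two_lt h.B_le h.le_A h.min_pos h.r_bounds hμ hcell]
    constructor <;> intro ε hε
    · filter_upwards [h1 (ε / 2) (by linarith), e1 (ε / 2) (by linarith)] with n f1 f2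
      have := (abs_le.1 f2).1
      linarith
    · refine ((h2 (ε / 2) (by linarith)).and_eventually (e1 (ε / 2) (by linarith))).mono ?_
      rintro n ⟨f1, f2⟩
      have := (abs_le.1 f2).2
      linarith
  · rw [upperLocalDim_eq_iff h.two_lt h.B_le h.le_A h.min_pos h.r_bounds hμ hcell]
    constructor <;> intro ε hε
    · filter_upwards [h3 (ε / 2) (by linarith), e1 (ε / 2) (by linarith)] with n f1 f2
      have := (abs_le.1 f2).2
      linarith
    · refine ((h4 (ε / 2) (by linarith)).and_eventually (e1 (ε / 2) (by linarith))).mono ?_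
      rintro n ⟨f1, f2⟩
      have := (abs_le.1 f2).1
      linarith
  · filter_upwards [h5 (ε / 2) (by linarith), e2 (ε / 2) (by linarith)] with n f1 f2
    rw [prefixMass_eq_exp hρ hθ]
    refine Real.exp_le_exp.2 ?_
    have := (abs_le.1 f2).1
    linarith

lemma meanSum_sub_succ (c r θ : ℕ → ℝ) (a : ℝ) (n : ℕ) :
    (meanSum r θ (n + 1) - a * logScale c (n + 1)) - (meanSum r θ n - a * logScale c n) =
      meanInfo (r (n + 1)) (θ n) - a * Real.log (c (n + 1)) := by
  simp only [meanSum, logScale, Finset.sum_range_succ]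
  ring

lemma abs_meanInfo_sub_le (h : TwoScale A B p q N c r) {t : ℝ} (ht : 0 ≤ t ∧ t ≤ 1) (a : ℝ)
    (n : ℕ) : |meanInfo (r (n + 1)) t - a * Real.log (c (n + 1))| ≤
      -Real.log (min p q) + |a| * Real.log A := by
  have h1 := meanInfo_mem_Icc h.min_pos (h.r_bounds n) ht
  have h2 : 0 < c (n + 1) := by linarith [h.B_le n, h.two_lt]
  have h3 : 0 ≤ Real.log (c (n + 1)) := Real.log_nonneg (by linarith [h.B_le n, h.two_lt])
  have h4 := Real.log_le_log h2 (h.le_A n)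
  refine (abs_sub _ _).trans (add_le_add ?_ ?_)
  · rw [abs_of_nonneg h1.1]; exact h1.2
  · rw [abs_mul, abs_of_nonneg h3]; gcongr

lemma meanSum_block_end (h : TwoScale A B p q N c r) {θ : ℕ → ℝ} (hθ : ∀ k, 0 ≤ θ k ∧ θ k ≤ 1)
    (a : ℝ) {ε : ℝ} (hε : 0 < ε) :
    ∀ᶠ j in atTop, (∀ k, N j ≤ k → k < N (j + 1) →
      meanInfo (r (k + 1)) (θ k) = a * Real.log (c (k + 1))) →
      |meanSum r θ (N (j + 1)) - a * logScale c (N (j + 1))| ≤ ε * logScale c (N (j + 1)) := by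
  have hev := h.eventually_abs_le_of_const (D := fun n => meanSum r θ n - a * logScale c n)
    (K := -Real.log (min p q) + |a| * Real.log A)
    (by simp [meanSum, logScale]) (fun n => by
      rw [meanSum_sub_succ]
      exact h.abs_meanInfo_sub_le (hθ n) a n) hε
  filter_upwards [hev] with j hj hconst
  refine hj fun k hk1 hk2 => ?_
  have := meanSum_sub_succ c r θ a k
  rw [hconst k hk1 hk2] at this
  linarith

/-- Lower bound using one law on the `A`-blocks and one on the `B`-blocks. -/
lemma le_dimH_of_two_laws (h : TwoScale A B p q N c r)
    (hμ : ∀ w : List Bool, μ (moranI c w) = ENNReal.ofReal (cylMass r w 1 1))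
    {s t α α' d : ℝ} (hs : 0 < s ∧ s < 1) (ht : 0 < t ∧ t < 1) (hαα' : α ≤ α')
    (hsm : meanInfo p s = α * Real.log A) (htm : meanInfo q t = α' * Real.log B)
    (hsd : d * Real.log A ≤ Real.binEntropy s) (htd : d * Real.log B ≤ Real.binEntropy t) :
    ENNReal.ofReal d ≤
      dimH {x | x ∈ moranSet c ∧ lowerLocalDim μ x = α ∧ upperLocalDim μ x = α'} := by
  classical
  have hAB : B ≠ A := h.lt_AB.ne
  set θ : ℕ → ℝ := fun k => if c (k + 1) = A then s else t with hθdef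
  have hcases : ∀ k, (c (k + 1) = A ∧ r (k + 1) = p ∧ θ k = s) ∨
      (c (k + 1) = B ∧ r (k + 1) = q ∧ θ k = t) := by
    intro k
    rcases h.cases k with h1 | h1
    · exact Or.inl ⟨h1.1, h1.2, by simp [hθdef, h1.1]⟩
    · exact Or.inr ⟨h1.1, h1.2, by simp [hθdef, h1.1, hAB]⟩
  set ρ := min (min s (1 - s)) (min t (1 - t)) with hρ
  have e1 : ρ ≤ s := (min_le_left _ _).trans (min_le_left _ _)
  have e2 : ρ ≤ 1 - s := (min_le_left _ _).trans (min_le_right _ _)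
  have e3 : ρ ≤ t := (min_le_right _ _).trans (min_le_left _ _)
  have e4 : ρ ≤ 1 - t := (min_le_right _ _).trans (min_le_right _ _)
  have hρ0 : 0 < ρ := lt_min (lt_min hs.1 (by linarith)) (lt_min ht.1 (by linarith))
  have hθ : ∀ k, ρ ≤ θ k ∧ θ k ≤ 1 - ρ := by
    intro k
    rcases hcases k with h1 | h1 <;> rw [h1.2.2] <;> constructor <;> linarith
  have hθ1 : ∀ k, 0 ≤ θ k ∧ θ k ≤ 1 := fun k =>
    ⟨hρ0.le.trans (hθ k).1, (hθ k).2.trans (by linarith)⟩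
  have hA := h.log_A_pos
  have hB := h.log_B_pos
  have hlow : ∀ n, α * logScale c n ≤ meanSum r θ n := mul_logScale_le_sum fun k => by
    rcases hcases k with ⟨h1, h2, h3⟩ | ⟨h1, h2, h3⟩ <;> rw [h1, h2, h3]
    · exact hsm.ge
    · rw [htm]; gcongr
  have hup : ∀ n, meanSum r θ n ≤ α' * logScale c n := sum_le_mul_logScale fun k => by
    rcases hcases k with ⟨h1, h2, h3⟩ | ⟨h1, h2, h3⟩ <;> rw [h1, h2, h3]
    · rw [hsm]; gcongr
    · exact htm.le
  have hent : ∀ n, d * logScale c n ≤ entropySum θ n := mul_logScale_le_sum fun k => by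
    rcases hcases k with ⟨h1, h2, h3⟩ | ⟨h1, h2, h3⟩ <;> rwa [h1, h3]
  refine h.le_dimH_of_bernoulli hμ hρ0 hθ (fun ε hε => Eventually.of_forall fun n => ?_)
    (fun ε hε => ?_) (fun ε hε => Eventually.of_forall fun n => ?_) (fun ε hε => ?_)
    (fun ε hε => Eventually.of_forall fun n => ?_)
  · have := mul_nonneg hε.le (h.logScale_nonneg n)
    linarith [hlow n]
  · have hf : Tendsto (fun i : ℕ => 2 * i) atTop atTop :=
      tendsto_atTop_mono (fun i => show i ≤ _ by omega) tendsto_id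
    refine h.frequently_of_eventually_N ((tendsto_add_atTop_nat 1).comp hf) ?_
    filter_upwards [hf.eventually (h.meanSum_block_end hθ1 α hε)] with i hi
    have := le_of_abs_le (hi fun k hk1 hk2 => by
      obtain ⟨h1, h2⟩ := h.even_block hk1 hk2
      simp only [hθdef]
      rw [if_pos h1, h1, h2, hsm])
    simp only [Function.comp_apply]
    linarith
  · have := mul_nonneg hε.le (h.logScale_nonneg n)
    linarith [hup n]
  · have hf : Tendsto (fun i : ℕ => 2 * i + 1) atTop atTop :=
      tendsto_atTop_mono (fun i => show i ≤ _ by omega) tendsto_id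
    refine h.frequently_of_eventually_N ((tendsto_add_atTop_nat 1).comp hf) ?_
    filter_upwards [hf.eventually (h.meanSum_block_end hθ1 α' hε)] with i hi
    have := neg_le_of_abs_le (hi fun k hk1 hk2 => by
      obtain ⟨h1, h2⟩ := h.odd_block hk1 hk2
      simp only [hθdef]
      rw [if_neg (by rw [h1]; exact hAB), h1, h2, htm])
    simp only [Function.comp_apply]
    linarith
  · have := mul_nonneg hε.le (h.logScale_nonneg n)
    linarith [hent n]

end TwoScale

/-- A greedy walk: inside the stretches `Z` the increment `g₁` is used as long as the walk has
stayed positive since the beginning of the stretch, and the increment `g₂` is used otherwise. -/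
lemma exists_greedy_walk (g₁ g₂ : ℕ → ℝ) (Z : Set ℕ) : ∃ (G : ℕ → ℝ) (e : Set ℕ),
    G 0 = 0 ∧ (∀ k ∈ e, G (k + 1) = G k + g₁ k) ∧ (∀ k ∉ e, G (k + 1) = G k + g₂ k) ∧
    (∀ k ∈ e, k ∈ Z ∧ 0 < G k) ∧
    ∀ k, k + 1 ∈ e ↔ k + 1 ∈ Z ∧ 0 < G (k + 1) ∧ (k ∈ Z → k ∈ e) := by
  classical
  let st : ℕ → ℝ × Prop := fun n => Nat.rec (0, True) (fun k s =>
    (if k ∈ Z ∧ 0 < s.1 ∧ s.2 then s.1 + g₁ k else s.1 + g₂ k,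
      k ∈ Z → k ∈ Z ∧ 0 < s.1 ∧ s.2)) n
  have hst : ∀ k, st (k + 1) =
    (if k ∈ Z ∧ 0 < (st k).1 ∧ (st k).2 then (st k).1 + g₁ k else (st k).1 + g₂ k,
      k ∈ Z → k ∈ Z ∧ 0 < (st k).1 ∧ (st k).2) := fun k => rfl
  refine ⟨fun k => (st k).1, {k | k ∈ Z ∧ 0 < (st k).1 ∧ (st k).2}, rfl, ?_, ?_, ?_, ?_⟩
  · intro k hk
    rw [Set.mem_ofPred_eq] at hk
    simp only [hst k]
    rw [if_pos hk]
  · intro k hk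
    rw [Set.mem_ofPred_eq] at hk
    simp only [hst k]
    rw [if_neg hk]
  · exact fun k hk => ⟨hk.1, hk.2.1⟩
  · intro k
    have h2 : (st (k + 1)).2 = (k ∈ Z → k ∈ Z ∧ 0 < (st k).1 ∧ (st k).2) := by rw [hst k]
    simp only [Set.mem_ofPred_eq]
    rw [h2]

namespace TwoScale
variable {A B p q : ℝ} {N : ℕ → ℕ} {c r : ℕ → ℝ}
variable {μ : Measure ℝ} [IsProbabilityMeasure μ]

lemma logScale_mono (h : TwoScale A B p q N c r) : Monotone (logScale c) := by
  refine monotone_nat_of_le_succ fun n => ?_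
  rw [logScale_succ]
  have := Real.log_nonneg (by linarith [h.B_le n, h.two_lt] : 1 ≤ c (n + 1))
  linarith

lemma eventually_le_logScale (h : TwoScale A B p q N c r) (K : ℝ) {ε : ℝ} (hε : 0 < ε) :
    ∀ᶠ n in atTop, K ≤ ε * logScale c n := by
  filter_upwards [(tendsto_logScale h.two_lt h.B_le h.le_A).eventually_ge_atTop (K / ε)]
    with n hn
  rwa [div_le_iff₀' hε] at hn

lemma block_unique (h : TwoScale A B p q N c r) {i j k : ℕ} (h1 : N i ≤ k) (h2 : k < N (i + 1))
    (h3 : N j ≤ k) (h4 : k < N (j + 1)) : i = j := by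
  have h5 := h.N_mono.lt_iff_lt.1 (h1.trans_lt h4)
  have h6 := h.N_mono.lt_iff_lt.1 (h3.trans_lt h2)
  omega

/-- Lower bound in the regime where neither target is reached by an exact dimensional mass on
its own blocks: the `A`-blocks interpolate between the natural and the uniform law. -/
lemma le_dimH_of_mixing (h : TwoScale A B p q N c r)
    (hμ : ∀ w : List Bool, μ (moranI c w) = ENNReal.ofReal (cylMass r w 1 1))
    {t α α' d : ℝ} (ht : 0 < t ∧ t < 1)
    (hα1 : Real.binEntropy p < α * Real.log A) (hα2 : α * Real.log A ≤ meanInfo p (1 / 2))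
    (hα3 : α * Real.log B ≤ Real.binEntropy q)
    (hpα' : meanInfo p (1 / 2) ≤ α' * Real.log A) (hqα' : Real.binEntropy q ≤ α' * Real.log B)
    (htm : meanInfo q t = α' * Real.log B)
    (hdα : d ≤ α) (hd2 : d * Real.log A ≤ Real.log 2) (htd : d * Real.log B ≤ Real.binEntropy t) :
    ENNReal.ofReal d ≤
      dimH {x | x ∈ moranSet c ∧ lowerLocalDim μ x = α ∧ upperLocalDim μ x = α'} := by
  classical
  have hA := h.log_A_pos
  have hB := h.log_B_pos
  choose blk hblk1 hblk2 using exists_block h.N_zero h.N_mono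
  have hblk : ∀ {j k : ℕ}, N j ≤ k → k < N (j + 1) → blk k = j := fun h1 h2 =>
    h.block_unique (hblk1 _) (hblk2 _) h1 h2
  have heven : ∀ k, (blk k % 4 = 0 ∨ blk k % 4 = 2) → c (k + 1) = A ∧ r (k + 1) = p := by
    intro k hk
    obtain ⟨i, hi⟩ : ∃ i, blk k = 2 * i := ⟨blk k / 2, by omega⟩
    exact h.even_block (i := i) (hi ▸ hblk1 k) (hi ▸ hblk2 k)
  have hodd : ∀ k, (blk k % 4 = 1 ∨ blk k % 4 = 3) → c (k + 1) = B ∧ r (k + 1) = q := by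
    intro k hk
    obtain ⟨i, hi⟩ : ∃ i, blk k = 2 * i + 1 := ⟨blk k / 2, by omega⟩
    have h2 := hblk2 k
    rw [hi] at h2
    exact h.odd_block (i := i) (hi ▸ hblk1 k) h2
  set θ' : ℕ → ℝ := fun k => if blk k % 4 = 1 then t else if blk k % 4 = 3 then q else 1 / 2
    with hθ'
  obtain ⟨G, e, hG0, hGe, hGne, heZ, hesucc⟩ := exists_greedy_walk
    (fun k => meanInfo (r (k + 1)) p - α * Real.log (c (k + 1)))
    (fun k => meanInfo (r (k + 1)) (θ' k) - α * Real.log (c (k + 1))) {k | blk k % 4 = 0}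
  simp only [Set.mem_ofPred_eq] at heZ hesucc
  set θ : ℕ → ℝ := fun k => if k ∈ e then p else θ' k with hθdef
  have hGM : ∀ n, G n = meanSum r θ n - α * logScale c n := by
    intro n
    induction n with
    | zero => simp [hG0, meanSum, logScale]
    | succ n ih =>
      have h1 := meanSum_sub_succ c r θ α n
      by_cases hn : n ∈ e
      · have h2 := hGe n hn
        have h3 : θ n = p := if_pos hn
        rw [h3] at h1
        linarith
      · have h2 := hGne n hn
        have h3 : θ n = θ' n := if_neg hn
        rw [h3] at h1
        linarith
  have htypes : ∀ k,
      (k ∈ e ∧ blk k % 4 = 0 ∧ θ k = p ∧ c (k + 1) = A ∧ r (k + 1) = p) ∨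
      (k ∉ e ∧ (blk k % 4 = 0 ∨ blk k % 4 = 2) ∧ θ k = 1 / 2 ∧ c (k + 1) = A ∧ r (k + 1) = p) ∨
      (k ∉ e ∧ blk k % 4 = 1 ∧ θ k = t ∧ c (k + 1) = B ∧ r (k + 1) = q) ∨
      (k ∉ e ∧ blk k % 4 = 3 ∧ θ k = q ∧ c (k + 1) = B ∧ r (k + 1) = q) := by
    intro k
    by_cases hk : k ∈ e
    · have h0 := (heZ k hk).1
      exact Or.inl ⟨hk, h0, if_pos hk, heven k (Or.inl h0)⟩
    · have h1 : θ k = θ' k := if_neg hk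
      obtain h2 | h2 | h2 : (blk k % 4 = 0 ∨ blk k % 4 = 2) ∨ blk k % 4 = 1 ∨ blk k % 4 = 3 := by
        omega
      · refine Or.inr (Or.inl ⟨hk, h2, ?_, heven k h2⟩)
        rw [h1, hθ']
        simp only
        rw [if_neg (by omega), if_neg (by omega)]
      · refine Or.inr (Or.inr (Or.inl ⟨hk, h2, ?_, hodd k (Or.inl h2)⟩))
        rw [h1, hθ']
        simp only
        rw [if_pos h2]
      · refine Or.inr (Or.inr (Or.inr ⟨hk, h2, ?_, hodd k (Or.inr h2)⟩))
        rw [h1, hθ']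
        simp only
        rw [if_neg (by omega), if_pos h2]
  have hp0 := h.p_pos
  have hp2 := h.p_le
  have hq0 := h.q_pos
  have hq2 := h.q_le
  set ρ := min (min p q) (min t (1 - t)) with hρ
  have e1 : ρ ≤ p := (min_le_left _ _).trans (min_le_left _ _)
  have e2 : ρ ≤ q := (min_le_left _ _).trans (min_le_right _ _)
  have e3 : ρ ≤ t := (min_le_right _ _).trans (min_le_left _ _)
  have e4 : ρ ≤ 1 - t := (min_le_right _ _).trans (min_le_right _ _)
  have hρ0 : 0 < ρ := lt_min h.min_pos (lt_min ht.1 (by linarith))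
  have hθ : ∀ k, ρ ≤ θ k ∧ θ k ≤ 1 - ρ := by
    intro k
    rcases htypes k with h1 | h1 | h1 | h1 <;> rw [h1.2.2.1] <;> constructor <;> linarith
  have hθ1 : ∀ k, 0 ≤ θ k ∧ θ k ≤ 1 := fun k =>
    ⟨hρ0.le.trans (hθ k).1, (hθ k).2.trans (by linarith)⟩
  have hαα' : α ≤ α' := by
    have := hα3.trans hqα'
    exact le_of_mul_le_mul_right this hB
  have hαα'A : α * Real.log A ≤ α' * Real.log A := by gcongr
  have hdB : d * Real.log B ≤ α * Real.log B := by gcongr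
  have hhalf : Real.binEntropy (1 / 2) = Real.log 2 := by
    rw [one_div, Real.binEntropy_two_inv]
  set K := -Real.log (min p q) + |α| * Real.log A with hK
  have hGstep : ∀ k, |G (k + 1) - G k| ≤ K := by
    intro k
    rw [hGM, hGM, meanSum_sub_succ]
    exact h.abs_meanInfo_sub_le (hθ1 k) α k
  have hK0 : 0 ≤ K := (abs_nonneg _).trans (hGstep 0)
  have hinc : ∀ k ∉ e, α * Real.log (c (k + 1)) ≤ meanInfo (r (k + 1)) (θ k) := by
    intro k hk
    rcases htypes k with h1 | ⟨-, -, h1, h2, h3⟩ | ⟨-, -, h1, h2, h3⟩ | ⟨-, -, h1, h2, h3⟩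
    · exact absurd h1.1 hk
    · rwa [h1, h2, h3]
    · rw [h1, h2, h3, htm]; gcongr
    · rw [h1, h2, h3, meanInfo_self]; exact hα3
  have hGlow : ∀ n, -K ≤ G n := by
    intro n
    induction n with
    | zero => rw [hG0]; linarith
    | succ n ih =>
      by_cases hn : n ∈ e
      · have h1 := (heZ n hn).2
        have h2 := neg_le_of_abs_le (hGstep n)
        linarith
      · have h1 := hinc n hn
        have h2 := meanSum_sub_succ c r θ α n
        rw [← hGM, ← hGM] at h2
        linarith
  have hup : ∀ n, meanSum r θ n ≤ α' * logScale c n := sum_le_mul_logScale fun k => by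
    rcases htypes k with ⟨-, -, h1, h2, h3⟩ | ⟨-, -, h1, h2, h3⟩ | ⟨-, -, h1, h2, h3⟩ |
      ⟨-, -, h1, h2, h3⟩ <;> rw [h1, h2, h3]
    · rw [meanInfo_self]; linarith
    · exact hpα'
    · exact htm.le
    · rw [meanInfo_self]; exact hqα'
  set D : ℕ → ℝ := fun n => entropySum θ n - meanSum r θ n with hD
  have hDstep : ∀ n, D (n + 1) - D n =
      Real.binEntropy (θ n) - meanInfo (r (n + 1)) (θ n) := by
    intro n
    simp only [hD, entropySum, meanSum, Finset.sum_range_succ]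
    ring
  have hDconst : ∀ k, (k ∈ e ∨ blk k % 4 = 3) → D (k + 1) = D k := by
    intro k hk
    have h0 := hDstep k
    rcases htypes k with ⟨-, -, h1, h2, h3⟩ | ⟨h4, h5, h1, h2, h3⟩ | ⟨h4, h5, h1, h2, h3⟩ |
      ⟨-, -, h1, h2, h3⟩
    · rw [h1, h3, meanInfo_self] at h0; linarith
    · rcases hk with hk | hk
      · exact absurd hk h4
      · omega
    · rcases hk with hk | hk
      · exact absurd hk h4
      · omega
    · rw [h1, h3, meanInfo_self] at h0; linarith
  have hDend : ∀ ε > 0, ∀ᶠ i in atTop,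
      |D (N (4 * i + 3 + 1))| ≤ ε * logScale c (N (4 * i + 3 + 1)) := by
    intro ε hε
    have hf : Tendsto (fun i : ℕ => 4 * i + 3) atTop atTop :=
      tendsto_atTop_mono (fun i => show i ≤ _ by omega) tendsto_id
    filter_upwards [hf.eventually (h.eventually_abs_le_of_const (D := D)
      (K := Real.log 2 + -Real.log (min p q))
      (by simp [hD, entropySum, meanSum]) (fun n => by
        rw [hDstep]
        refine (abs_sub _ _).trans (add_le_add ?_ ?_)
        · rw [abs_of_nonneg (Real.binEntropy_nonneg (hθ1 n).1 (hθ1 n).2)]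
          exact Real.binEntropy_le_log_two
        · have := meanInfo_mem_Icc h.min_pos (h.r_bounds n) (hθ1 n)
          rw [abs_of_nonneg this.1]
          exact this.2) hε)] with i hi
    refine hi fun k hk1 hk2 => hDconst k (Or.inr ?_)
    rw [hblk hk1 hk2]
    omega
  have hrun : ∀ j k, N j ≤ k → k < N (j + 1) → k ∈ e → ∀ i, N j ≤ k - i → k - i ∈ e := by
    intro j k hk1 hk2 hk i
    induction i with
    | zero => intro _; exact hk
    | succ i ih =>
      intro hi
      rcases Nat.eq_zero_or_pos (k - i) with h0 | h0
      · rw [show k - (i + 1) = k - i by omega]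
        exact ih (by omega)
      · have h1 := ih (by omega)
        rw [show k - i = k - (i + 1) + 1 by omega, hesucc] at h1
        refine h1.2.2 ?_
        rw [hblk hi (by omega), ← hblk hk1 hk2]
        exact (heZ k hk).1
  have hent : ∀ ε > 0, ∀ᶠ n in atTop, (d - ε) * logScale c n ≤ entropySum θ n := by
    intro ε hε
    have hε2 : 0 < ε / 2 := by linarith
    obtain ⟨i₀, hi₀⟩ := eventually_atTop.1 (hDend _ hε2)
    obtain ⟨n₁, hn₁⟩ := eventually_atTop.1 (h.eventually_le_logScale K hε2)
    have hbase : ∀ n ≥ n₁, -(ε / 2 * logScale c n) ≤ D n →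
        (d - ε) * logScale c n ≤ entropySum θ n := by
      intro n hn hDn
      have h1 := hn₁ n hn
      have h2 := hGlow n
      rw [hGM] at h2
      simp only [hD] at hDn
      have h3 := mul_le_mul_of_nonneg_right hdα (h.logScale_nonneg n)
      linarith
    set I := max i₀ n₁ with hI
    have hIn : n₁ ≤ N (4 * I + 3 + 1) := by
      have h1 := h.N_mono.id_le (4 * I + 3 + 1)
      have h2 := le_max_right i₀ n₁
      simp only [id] at h1
      omega
    filter_upwards [eventually_ge_atTop (N (4 * I + 3 + 1))] with n hn
    induction n, hn using Nat.le_induction with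
    | base => exact hbase _ hIn (neg_le_of_abs_le (hi₀ I (le_max_left _ _)))
    | succ k hk ih =>
      by_cases hke : k ∈ e
      · refine hbase (k + 1) (by omega) ?_
        have h0 := (heZ k hke).1
        have h1 : 4 * I + 3 + 1 ≤ blk k := by
          have := h.N_mono.lt_iff_lt.1 (hk.trans_lt (hblk2 k))
          omega
        obtain ⟨i, hi⟩ : ∃ i, blk k = 4 * i + 3 + 1 := ⟨blk k / 4 - 1, by omega⟩
        have hi0 : i₀ ≤ i := by
          have := le_max_left i₀ n₁
          omega
        have h2 : D (k + 1) = D (N (blk k)) := by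
          refine eq_of_increment_eq ((hblk1 k).trans (Nat.le_succ k)) fun m hm1 hm2 => ?_
          have h3 := hrun (blk k) k (hblk1 k) (hblk2 k) hke (k - m) (by omega)
          rw [show k - (k - m) = m by omega] at h3
          exact hDconst m (Or.inl h3)
        have h3 := neg_le_of_abs_le (hi₀ i hi0)
        rw [← hi] at h3
        have h4 := h.logScale_mono ((hblk1 k).trans (Nat.le_succ k))
        have h5 := mul_le_mul_of_nonneg_left h4 hε2.le
        rw [h2]
        linarith
      · have h1 : d * Real.log (c (k + 1)) ≤ Real.binEntropy (θ k) := by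
          rcases htypes k with h1 | ⟨-, -, h1, h2, h3⟩ | ⟨-, -, h1, h2, h3⟩ | ⟨-, -, h1, h2, h3⟩
          · exact absurd h1.1 hke
          · rw [h1, h2, hhalf]; exact hd2
          · rw [h1, h2]; exact htd
          · rw [h1, h2]; linarith
        have h2 := Real.log_nonneg (by linarith [h.B_le k, h.two_lt] : 1 ≤ c (k + 1))
        have h3 : entropySum θ (k + 1) = entropySum θ k + Real.binEntropy (θ k) := by
          simp only [entropySum, Finset.sum_range_succ]
        rw [h3, logScale_succ]
        have h4 := mul_nonneg hε.le h2
        linarith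
  refine h.le_dimH_of_bernoulli hμ hρ0 hθ (fun ε hε => ?_)
    (fun ε hε => ?_) (fun ε hε => Eventually.of_forall fun n => ?_) (fun ε hε => ?_) hent
  · filter_upwards [h.eventually_le_logScale K hε] with n hn
    have := hGlow n
    rw [hGM] at this
    linarith
  · by_contra hcon
    rw [not_frequently] at hcon
    obtain ⟨n₁, hn₁⟩ := eventually_atTop.1 hcon
    have hpos : ∀ n ≥ n₁, 0 < G n := by
      intro n hn
      have h1 := not_le.1 (hn₁ n hn)
      have h2 := mul_nonneg hε.le (h.logScale_nonneg n)
      rw [hGM]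
      linarith
    set a := Real.binEntropy p / Real.log A with ha
    have haA : a * Real.log A = Real.binEntropy p := div_mul_cancel₀ _ hA.ne'
    have haα : 0 < α - a := by
      rw [sub_pos, ha, div_lt_iff₀ hA]; exact hα1
    have hf : Tendsto (fun i : ℕ => 4 * i) atTop atTop :=
      tendsto_atTop_mono (fun i => show i ≤ _ by omega) tendsto_id
    obtain ⟨i, hi, hin⟩ := ((hf.eventually (h.meanSum_block_end hθ1 a haα)).and
      (eventually_ge_atTop (n₁ + 1))).exists
    have hNi : n₁ < N (4 * i) := by
      have := h.N_mono.id_le (4 * i)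
      simp only [id] at this
      omega
    have hall : ∀ k, N (4 * i) ≤ k → k < N (4 * i + 1) → k ∈ e := by
      intro k hk
      induction k, hk using Nat.le_induction with
      | base =>
        intro hk2
        obtain ⟨m, hm⟩ : ∃ m, N (4 * i) = m + 1 := ⟨N (4 * i) - 1, by omega⟩
        rw [hm, hesucc, ← hm, hblk le_rfl hk2]
        refine ⟨by omega, hpos _ hNi.le, fun hm0 => ?_⟩
        have h1 : N (4 * i - 1) ≤ m := by
          have := h.N_mono (show 4 * i - 1 < 4 * i by omega)
          omega
        have h2 : m < N (4 * i - 1 + 1) := by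
          rw [show 4 * i - 1 + 1 = 4 * i by omega]; omega
        rw [hblk h1 h2] at hm0
        omega
      | succ k hk ih =>
        intro hk2
        rw [hesucc, hblk (by omega) hk2]
        exact ⟨by omega, hpos _ (by omega), fun _ => ih (by omega)⟩
    have h1 := le_of_abs_le (hi fun k hk1 hk2 => by
      have hke := hall k hk1 hk2
      obtain ⟨h2, h3⟩ := heven k (Or.inl (heZ k hke).1)
      rw [show θ k = p from if_pos hke, h2, h3, meanInfo_self, haA])
    have h2 := hpos (N (4 * i + 1)) (hNi.le.trans (h.N_mono.monotone (Nat.le_succ _)))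
    rw [hGM] at h2
    linarith
  · have := mul_nonneg hε.le (h.logScale_nonneg n)
    linarith [hup n]
  · have hf : Tendsto (fun i : ℕ => 4 * i + 1) atTop atTop :=
      tendsto_atTop_mono (fun i => show i ≤ _ by omega) tendsto_id
    refine h.frequently_of_eventually_N ((tendsto_add_atTop_nat 1).comp hf) ?_
    filter_upwards [hf.eventually (h.meanSum_block_end hθ1 α' hε)] with i hi
    have := neg_le_of_abs_le (hi fun k hk1 hk2 => by
      have hb := hblk hk1 hk2
      rcases htypes k with ⟨-, h0, -⟩ | ⟨-, h0, -⟩ | ⟨-, -, h1, h2, h3⟩ | ⟨-, h0, -⟩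
      · omega
      · omega
      · rw [h1, h2, h3, htm]
      · omega)
    simp only [Function.comp_apply]
    linarith

end TwoScale

lemma ENNReal.eq_zero_of_forall_le_ofReal {x : ENNReal}
    (hx : ∀ ε : ℝ, 0 < ε → x ≤ ENNReal.ofReal ε) :
    x = 0 := by
  refine nonpos_iff_eq_zero.mp (le_of_forall_gt fun a ha => ?_)
  obtain ⟨b, hb0, hba⟩ := ENNReal.lt_iff_exists_nnreal_btwn.mp ha
  refine lt_of_le_of_lt (hx b (by exact_mod_cast hb0)) ?_
  rwa [ENNReal.ofReal_coe_nnreal]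

section Exponents

variable {A B p q : ℝ} {N : ℕ → ℕ} {c r : ℕ → ℝ} {μ : Measure ℝ} [IsProbabilityMeasure μ]

/-- Either the sets of prescribed lower local dimension `α` have dimension zero, or `α` is a mean
information per unit of logarithmic scale and the dimension is at most the corresponding
entropy. -/
lemma TwoScale.dimH_lower_dichotomy (h : TwoScale A B p q N c r)
    (hμ : ∀ w : List Bool, μ (moranI c w) = ENNReal.ofReal (cylMass r w 1 1)) {α : ℝ}
    (h1 : -Real.log (1 - p) ≤ α * Real.log A) (h2 : α * Real.log A ≤ -Real.log p)
    (hout : α * Real.log A ≤ Real.binEntropy p ∨ meanInfo p (1 / 2) ≤ α * Real.log A) :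
    dimH {x | x ∈ moranSet c ∧ lowerLocalDim μ x = α} = 0 ∨
      ∃ t, 0 < t ∧ t < 1 ∧ meanInfo p t = α * Real.log A ∧
        dimH {x | x ∈ moranSet c ∧ lowerLocalDim μ x = α} ≤
          ENNReal.ofReal (Real.binEntropy t / Real.log A) := by
  have hA := h.log_A_pos
  obtain ⟨S, hS, hS'⟩ : ∃ S : Set ℝ, (S = Ici 1 ∧ α * Real.log A ≤ meanInfo p p ∨
      S = Iic 0 ∧ meanInfo p (1 / 2) ≤ α * Real.log A ∨ S = univ) ∧
      ∀ s ∈ S, s ≤ 0 ∨ 1 ≤ s := by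
    rcases hout with ho | ho
    · exact ⟨Ici 1, Or.inl ⟨rfl, by rwa [meanInfo_self]⟩, fun s hs => Or.inr hs⟩
    · exact ⟨Iic 0, Or.inr (Or.inl ⟨rfl, ho⟩), fun s hs => Or.inl hs⟩
  have key : ∀ s ∈ S, ∀ y, s * (α * Real.log A) + pressure p s ≤ y →
      dimH {x | x ∈ moranSet c ∧ lowerLocalDim μ x = α} ≤ ENNReal.ofReal (y / Real.log A) := by
    intro s hs y hy
    refine (h.dimH_lower_le hμ α (hS' s hs)).trans (ENNReal.ofReal_le_ofReal ?_)
    rw [le_div_iff₀ hA, add_mul, div_mul_cancel₀ _ hA.ne']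
    linarith
  rcases gibbs_or_legendre_small h.p_pos h.p_le h1 h2 S hS with ⟨s, hs, t, ht0, ht1, htm, hte⟩ | hsm
  · exact Or.inr ⟨t, ht0, ht1, htm, key s hs _ hte.ge⟩
  · refine Or.inl (ENNReal.eq_zero_of_forall_le_ofReal fun ε hε => ?_)
    obtain ⟨s, hs, hse⟩ := hsm (ε * Real.log A) (by positivity)
    simpa [hA.ne'] using key s hs _ hse

/-- Either the sets of prescribed upper local dimension `α'` have dimension zero, or `α'` is a mean
information per unit of logarithmic scale and the dimension is at most the corresponding
entropy. -/
lemma TwoScale.dimH_upper_dichotomy (h : TwoScale A B p q N c r)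
    (hμ : ∀ w : List Bool, μ (moranI c w) = ENNReal.ofReal (cylMass r w 1 1)) {α' : ℝ}
    (h1 : -Real.log (1 - q) ≤ α' * Real.log B) (h2 : α' * Real.log B ≤ -Real.log q) :
    dimH {x | x ∈ moranSet c ∧ upperLocalDim μ x = α'} = 0 ∨
      ∃ t, 0 < t ∧ t < 1 ∧ meanInfo q t = α' * Real.log B ∧
        dimH {x | x ∈ moranSet c ∧ upperLocalDim μ x = α'} ≤
          ENNReal.ofReal (Real.binEntropy t / Real.log B) := by
  have hB := h.log_B_pos
  have key : ∀ s y, s * (α' * Real.log B) + pressure q s ≤ y →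
      dimH {x | x ∈ moranSet c ∧ upperLocalDim μ x = α'} ≤ ENNReal.ofReal (y / Real.log B) := by
    intro s y hy
    refine (h.dimH_upper_le hμ α' s).trans (ENNReal.ofReal_le_ofReal ?_)
    rw [le_div_iff₀ hB, add_mul, div_mul_cancel₀ _ hB.ne']
    linarith
  rcases gibbs_or_legendre_small h.q_pos h.q_le h1 h2 univ (Or.inr (Or.inr rfl)) with
    ⟨s, -, t, ht0, ht1, htm, hte⟩ | hsm
  · exact Or.inr ⟨t, ht0, ht1, htm, key s _ hte.ge⟩
  · refine Or.inl (ENNReal.eq_zero_of_forall_le_ofReal fun ε hε => ?_)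
    obtain ⟨s, -, hse⟩ := hsm (ε * Real.log B) (by positivity)
    simpa [hB.ne'] using key s _ hse

end Exponents

/-- The mean information of a coin lies between the
smaller and the larger of the two informations. -/
lemma meanInfo_mem_Icc_log {ρ t : ℝ} (h0 : 0 < ρ) (h1 : ρ ≤ 1 / 2) (ht0 : 0 ≤ t) (ht1 : t ≤ 1) :
    -Real.log (1 - ρ) ≤ meanInfo ρ t ∧ meanInfo ρ t ≤ -Real.log ρ := by
  have := Real.log_le_log h0 (by linarith : ρ ≤ 1 - ρ)
  unfold meanInfo
  constructor <;> nlinarith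

/-- if (α,α') lies in [β₁'(+∞),β₁'(−∞)] × [β₂'(+∞),β₂'(−∞)] and it is NOT
the case that both β₁'(1) ≤ α ≤ β₁'(0) and β₂'(+∞) ≤ α' < β₂'(1), then
dim_H E(μ,α,α') = min{dim_H E̲(μ,α), dim_H Ē(μ,α')}. -/
theorem stmt_11 (A B p q : ℝ) (N : ℕ → ℕ)
    (hBA : B < A) (hB2 : 2 < B)
    (hp0 : 0 < p) (hp2 : p ≤ 1 / 2) (hq0 : 0 < q) (hq2 : q ≤ 1 / 2)
    (hN0 : N 0 = 0) (hNmono : StrictMono N)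
    (hNlim : Tendsto (fun i : ℕ => (N (i + 1) : ℝ) / (N i : ℝ)) atTop atTop)
    (hpq : -Real.log p / Real.log A < -Real.log (1 - q) / Real.log B)
    (c r : ℕ → ℝ)
    (hcA : ∀ i n : ℕ, N (2 * i) < n → n ≤ N (2 * i + 1) → c n = A)
    (hcB : ∀ i n : ℕ, N (2 * i + 1) < n → n ≤ N (2 * i + 2) → c n = B)
    (hrp : ∀ i n : ℕ, N (2 * i) < n → n ≤ N (2 * i + 1) → r n = p)
    (hrq : ∀ i n : ℕ, N (2 * i + 1) < n → n ≤ N (2 * i + 2) → r n = q)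
    (μ : Measure ℝ) [IsProbabilityMeasure μ]
    (hμ : ∀ w : List Bool, μ (moranI c w) = ENNReal.ofReal (cylMass r w 1 1))
    (α α' : ℝ)
    (hα1 : -Real.log (1 - p) / Real.log A ≤ α) (hα2 : α ≤ -Real.log p / Real.log A)
    (hα'1 : -Real.log (1 - q) / Real.log B ≤ α') (hα'2 : α' ≤ -Real.log q / Real.log B)
    (hnot : ¬ (deriv (betaFn p A) 1 ≤ α ∧ α ≤ deriv (betaFn p A) 0 ∧
      -Real.log (1 - q) / Real.log B ≤ α' ∧ α' < deriv (betaFn q B) 1)) :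
    dimH {x | x ∈ moranSet c ∧ lowerLocalDim μ x = α ∧ upperLocalDim μ x = α'} =
      min (dimH {x | x ∈ moranSet c ∧ lowerLocalDim μ x = α})
        (dimH {x | x ∈ moranSet c ∧ upperLocalDim μ x = α'}) := by
  have h : TwoScale A B p q N c r := ⟨hBA, hB2, hp0, hp2, hq0, hq2, hN0, hNmono, hNlim, hpq,
    hcA, hcB, hrp, hrq⟩
  have hA := h.log_A_pos
  have hB := h.log_B_pos
  refine le_antisymm (le_min (dimH_mono fun x hx => ⟨hx.1, hx.2.1⟩)
    (dimH_mono fun x hx => ⟨hx.1, hx.2.2⟩)) ?_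
  have hαα' : α ≤ α' := by linarith
  have hαB : α * Real.log B ≤ -Real.log (1 - q) := by
    rw [← le_div_iff₀ hB]; linarith
  have hα'A : -Real.log p ≤ α' * Real.log A := by
    rw [← div_le_iff₀ hA]; linarith
  rw [deriv_betaFn hp0 h.p_lt_one, deriv_betaFn hp0 h.p_lt_one, deriv_betaFn hq0 h.q_lt_one,
    gibbs_one, gibbs_one, gibbs_zero, meanInfo_self, meanInfo_self, div_le_iff₀ hA,
    le_div_iff₀ hA, lt_div_iff₀ hB] at hnot
  have hp' := hα'1
  rw [div_le_iff₀ hA] at hα1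
  rw [le_div_iff₀ hA] at hα2
  rw [div_le_iff₀ hB] at hα'1
  rw [le_div_iff₀ hB] at hα'2
  rcases h.dimH_upper_dichotomy hμ hα'1 hα'2 with h0 | ⟨t, ht0, ht1, htm, hte⟩
  · rw [h0]; simp
  by_cases hout : α * Real.log A ≤ Real.binEntropy p ∨ meanInfo p (1 / 2) ≤ α * Real.log A
  · rcases h.dimH_lower_dichotomy hμ hα1 hα2 hout with h0 | ⟨s, hs0, hs1, hsm, hse⟩
    · rw [h0]; simp
    refine (min_le_min hse hte).trans ?_
    rw [← (ENNReal.ofReal_mono).map_min]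
    exact h.le_dimH_of_two_laws hμ ⟨hs0, hs1⟩ ⟨ht0, ht1⟩ hαα' hsm htm
      ((le_div_iff₀ hA).mp (min_le_left _ _)) ((le_div_iff₀ hB).mp (min_le_right _ _))
  · simp only [not_or, not_le] at hout
    obtain ⟨hα3, hα4⟩ := hout
    have hqα' : Real.binEntropy q ≤ α' * Real.log B := by
      by_contra! hlt
      exact hnot ⟨hα3.le, hα4.le, hp', hlt⟩
    have e1 : dimH {x | x ∈ moranSet c ∧ lowerLocalDim μ x = α} ≤ ENNReal.ofReal α := by
      simpa [pressure_one] using h.dimH_lower_le hμ α (s := 1) (Or.inr le_rfl)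
    have e2 : dimH {x | x ∈ moranSet c ∧ lowerLocalDim μ x = α} ≤
        ENNReal.ofReal (Real.log 2 / Real.log A) := by
      simpa [pressure_zero] using h.dimH_lower_le hμ α (s := 0) (Or.inl le_rfl)
    refine (min_le_min (le_min e1 e2) hte).trans ?_
    rw [← (ENNReal.ofReal_mono).map_min, ← (ENNReal.ofReal_mono).map_min]
    refine h.le_dimH_of_mixing hμ ⟨ht0, ht1⟩ hα3 hα4.le ?_ ?_ hqα' htm
      ((min_le_left _ _).trans (min_le_left _ _))
      ((le_div_iff₀ hA).mp ((min_le_left _ _).trans (min_le_right _ _)))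
      ((le_div_iff₀ hB).mp (min_le_right _ _))
    · rw [← meanInfo_self]
      exact hαB.trans (meanInfo_mem_Icc_log hq0 hq2 hq0.le h.q_lt_one.le).1
    · exact (meanInfo_mem_Icc_log hp0 hp2 (by norm_num) (by norm_num)).2.trans hα'A
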